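/- arXiv:1804.01360 — 3 statements merged into one kernel-verified Lean document; each statement's English description precedes it below -/
import Mathlib

section
/- Let p > 3 be prime and let a, b, c ∈ {0, 1, ..., p−1}. The subgroup G = ⟨ρ, τ, σ·α₁^{a}α₂^{b}α₃^{c}⟩ of Hol(M₁) (where ρ, τ, σ act as left translations) is a regular subgroup of order p³; moreover G is abelian — and then elementary abelian, isomorphic to (ZMod p)³ — if and only if c ≡ 1 (mod p), and G is isomorphic to M₁ if and only if c ≢ 1 (mod p). -/
/-! ## The Heisenberg group of order `p³` -/

@[ext]
structure Heisenberg (p : ℕ) where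
  x : ZMod p
  y : ZMod p
  z : ZMod p

namespace Heisenberg

variable {p : ℕ}

instance : Mul (Heisenberg p) :=
  ⟨fun g h => ⟨g.x + h.x, g.y + h.y, g.z + h.z + h.x * g.y⟩⟩

instance : One (Heisenberg p) := ⟨⟨0, 0, 0⟩⟩

instance : Inv (Heisenberg p) := ⟨fun g => ⟨-g.x, -g.y, -g.z + g.x * g.y⟩⟩

@[simp] theorem mul_x (g h : Heisenberg p) : (g * h).x = g.x + h.x := rfl
@[simp] theorem mul_y (g h : Heisenberg p) : (g * h).y = g.y + h.y := rfl
@[simp] theorem mul_z (g h : Heisenberg p) : (g * h).z = g.z + h.z + h.x * g.y := rfl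
@[simp] theorem one_x : (1 : Heisenberg p).x = 0 := rfl
@[simp] theorem one_y : (1 : Heisenberg p).y = 0 := rfl
@[simp] theorem one_z : (1 : Heisenberg p).z = 0 := rfl
@[simp] theorem inv_x (g : Heisenberg p) : (g⁻¹).x = -g.x := rfl
@[simp] theorem inv_y (g : Heisenberg p) : (g⁻¹).y = -g.y := rfl
@[simp] theorem inv_z (g : Heisenberg p) : (g⁻¹).z = -g.z + g.x * g.y := rfl

instance : Group (Heisenberg p) where
  mul_assoc a b c := by ext <;> simp <;> ring
  one_mul a := by ext <;> simp
  mul_one a := by ext <;> simp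
  inv_mul_cancel a := by ext <;> simp <;> ring

/-- The generator `ρ` (a generator of the centre). -/
def ρ : Heisenberg p := ⟨0, 0, 1⟩

/-- The generator `σ`. -/
def σ : Heisenberg p := ⟨1, 0, 0⟩

/-- The generator `τ`. -/
def τ : Heisenberg p := ⟨0, 1, 0⟩

/-- The automorphism `α₁` determined by `σ ↦ ρσ`, `τ ↦ τ` (and `ρ ↦ ρ`). -/
def α₁ : MulAut (Heisenberg p) where
  toFun g := ⟨g.x, g.y, g.z + g.x⟩
  invFun g := ⟨g.x, g.y, g.z - g.x⟩
  left_inv g := by ext <;> simp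
  right_inv g := by ext <;> simp
  map_mul' g h := by ext <;> simp <;> ring

/-- The automorphism `α₃` determined by `σ ↦ σ`, `τ ↦ ρτ` (and `ρ ↦ ρ`). -/
def α₃ : MulAut (Heisenberg p) where
  toFun g := ⟨g.x, g.y, g.z + g.y⟩
  invFun g := ⟨g.x, g.y, g.z - g.y⟩
  left_inv g := by ext <;> simp
  right_inv g := by ext <;> simp
  map_mul' g h := by ext <;> simp <;> ring

/-- The automorphism `α₂` determined by `σ ↦ στ`, `τ ↦ τ` (and `ρ ↦ ρ`), for `p` an odd
prime. -/
def α₂ (p : ℕ) [Fact p.Prime] (hp : p ≠ 2) : MulAut (Heisenberg p) where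
  toFun g := ⟨g.x, g.x + g.y, g.z + g.x * (g.x - 1) / 2⟩
  invFun g := ⟨g.x, g.y - g.x, g.z - g.x * (g.x - 1) / 2⟩
  left_inv g := by ext <;> simp <;> ring
  right_inv g := by ext <;> simp <;> ring
  map_mul' g h := by
    have h2 : (2 : ZMod p) ≠ 0 := by
      intro h
      have h' : ((2 : ℕ) : ZMod p) = 0 := by exact_mod_cast h
      rw [CharP.cast_eq_zero_iff (ZMod p) p 2] at h'
      have h1 := Nat.le_of_dvd (by norm_num) h'
      have h2 := (Fact.out : p.Prime).two_le
      omega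
    ext <;> simp
    · ring
    · field_simp
      ring

end Heisenberg

open Heisenberg

/-! ## The holomorph of `M₁` inside the permutation group -/

/-- The left regular representation `M₁ → Perm M₁`. -/
def leftMulHom (p : ℕ) : Heisenberg p →* Equiv.Perm (Heisenberg p) :=
  MulAction.toPermHom (Heisenberg p) (Heisenberg p)

/-- The holomorph of `M₁`, realized as the subgroup of `Perm M₁` generated by left
translations and automorphisms of `M₁`. -/
def Hol (p : ℕ) : Subgroup (Equiv.Perm (Heisenberg p)) :=
  (leftMulHom p).range ⊔
    (MulAut.toPerm (Heisenberg p)).range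

/-- A subgroup of `Perm X` is regular if it acts freely and transitively on `X`. -/
def IsRegularSub {X : Type*} (H : Subgroup (Equiv.Perm X)) : Prop :=
  ∀ x y : X, ∃! g : Equiv.Perm X, g ∈ H ∧ g x = y

/-- The canonical projection `Θ : Hol(M₁) → Aut(M₁)` (with kernel the left translations),
written as a function on permutations: it sends `π` to `m ↦ (π 1)⁻¹ * π m`; on elements of the
holomorph, this is exactly the automorphism component. -/
def theta (p : ℕ) (π : Equiv.Perm (Heisenberg p)) : Equiv.Perm (Heisenberg p) :=
  (Equiv.mulLeft (π 1))⁻¹ * π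

/-- The cardinality of the image `Θ(G)` of a subgroup `G` of the holomorph under the canonical
projection `Θ`. -/
noncomputable def thetaCard (p : ℕ) (G : Subgroup (Equiv.Perm (Heisenberg p))) : ℕ :=
  Nat.card (theta p '' (G : Set (Equiv.Perm (Heisenberg p))))

/-- The conjugation action of `Aut(M₁)` (viewed inside `Perm M₁`) on subgroups of `Perm M₁`. -/
def autConj (p : ℕ) (α : MulAut (Heisenberg p)) (G : Subgroup (Equiv.Perm (Heisenberg p))) :
    Subgroup (Equiv.Perm (Heisenberg p)) :=
  Subgroup.map (MulAut.conj (MulAut.toPerm (Heisenberg p) α)).toMonoidHom G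


namespace Heisenberg

variable {p : ℕ} [Fact p.Prime]

theorem two_ne_zero_of_three_lt (h3 : 3 < p) : (2 : ZMod p) ≠ 0 := by
  intro h
  have h' : ((2 : ℕ) : ZMod p) = 0 := by exact_mod_cast h
  rw [CharP.cast_eq_zero_iff (ZMod p) p 2] at h'
  have := Nat.le_of_dvd (by norm_num) h'
  omega

theorem three_ne_zero_of_three_lt (h3 : 3 < p) : (3 : ZMod p) ≠ 0 := by
  intro h
  have h' : ((3 : ℕ) : ZMod p) = 0 := by exact_mod_cast h
  rw [CharP.cast_eq_zero_iff (ZMod p) p 3] at h'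
  have := Nat.le_of_dvd (by norm_num) h'
  omega

theorem α₁_pow_apply (n : ℕ) (g : Heisenberg p) :
    (α₁ ^ n) g = ⟨g.x, g.y, g.z + n * g.x⟩ := by
  induction n with
  | zero => ext <;> simp
  | succ n ih =>
    rw [pow_succ', MulAut.mul_apply, ih]
    ext <;> simp [α₁]
    ring

theorem α₃_pow_apply (n : ℕ) (g : Heisenberg p) :
    (α₃ ^ n) g = ⟨g.x, g.y, g.z + n * g.y⟩ := by
  induction n with
  | zero => ext <;> simp
  | succ n ih =>
    rw [pow_succ', MulAut.mul_apply, ih]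
    ext <;> simp [α₃]
    ring

theorem α₂_pow_apply (hp : p ≠ 2) (n : ℕ) (g : Heisenberg p) :
    (α₂ p hp ^ n) g = ⟨g.x, n * g.x + g.y, g.z + n * (g.x * (g.x - 1) / 2)⟩ := by
  induction n with
  | zero => ext <;> simp
  | succ n ih =>
    rw [pow_succ', MulAut.mul_apply, ih]
    ext <;> simp [α₂]
    · ring
    · ring

/-- The effect of `ρ ^ k * τ ^ j * s ^ i` on the group, where `s = σ * α₁ ^ a * α₂ ^ b * α₃ ^ c`,
as a polynomial map in the exponents. -/
def polyAct (a b c i j k : ZMod p) (g : Heisenberg p) : Heisenberg p :=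
  ⟨g.x + i,
    g.y + b * (i * g.x + i * (i - 1) / 2) + j,
    g.z + c * (i * g.y + b * (g.x * (i * (i - 1) / 2) + i * (i - 1) * (i - 2) / 6))
      + b * ((g.x + i) * (g.x + i - 1) * (g.x + i - 2) / 6 - g.x * (g.x - 1) * (g.x - 2) / 6)
      + a * ((g.x + i) * (g.x + i - 1) / 2 - g.x * (g.x - 1) / 2)
      + j * (g.x + i) + k⟩

theorem polyAct_polyAct (h3 : 3 < p) (a b c i j k i' j' k' : ZMod p) (g : Heisenberg p) :
    polyAct a b c i j k (polyAct a b c i' j' k' g) =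
      polyAct a b c (i + i') (j + j') (k + k' + (c - 1) * (i * j')) g := by
  have h2 := two_ne_zero_of_three_lt h3
  have h3' := three_ne_zero_of_three_lt h3
  have h6 : (6 : ZMod p) = 2 * 3 := by norm_num
  ext
  · simp only [polyAct]; ring
  · simp only [polyAct]; field_simp; ring
  · simp only [polyAct, h6]; field_simp; ring

theorem polyAct_zero (a b c : ZMod p) (g : Heisenberg p) : polyAct a b c 0 0 0 g = g := by
  ext <;> simp [polyAct]

/-- The permutation `ρ ^ k * τ ^ j * s ^ i`, where `s = σ * α₁ ^ a * α₂ ^ b * α₃ ^ c`. -/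
def polyPerm (h3 : 3 < p) (a b c i j k : ZMod p) : Equiv.Perm (Heisenberg p) where
  toFun := polyAct a b c i j k
  invFun := polyAct a b c (-i) (-j) (-k + (c - 1) * (i * j))
  left_inv g := by
    rw [polyAct_polyAct h3]
    convert polyAct_zero a b c g using 2 <;> ring
  right_inv g := by
    rw [polyAct_polyAct h3]
    convert polyAct_zero a b c g using 2 <;> ring

theorem polyPerm_mul (h3 : 3 < p) (a b c i j k i' j' k' : ZMod p) :
    polyPerm h3 a b c i j k * polyPerm h3 a b c i' j' k' =
      polyPerm h3 a b c (i + i') (j + j') (k + k' + (c - 1) * (i * j')) :=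
  Equiv.ext fun g => polyAct_polyAct h3 a b c i j k i' j' k' g

theorem polyPerm_zero (h3 : 3 < p) (a b c : ZMod p) : polyPerm h3 a b c 0 0 0 = 1 :=
  Equiv.ext fun g => polyAct_zero a b c g

theorem polyPerm_inv (h3 : 3 < p) (a b c i j k : ZMod p) :
    (polyPerm h3 a b c i j k)⁻¹ = polyPerm h3 a b c (-i) (-j) (-k + (c - 1) * (i * j)) :=
  Equiv.ext fun _ => rfl

theorem polyPerm_exponents_eq (h3 : 3 < p) {a b c i j k i' j' k' : ZMod p} {g : Heisenberg p}
    (h : polyPerm h3 a b c i j k g = polyPerm h3 a b c i' j' k' g) :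
    i = i' ∧ j = j' ∧ k = k' := by
  change polyAct a b c i j k g = polyAct a b c i' j' k' g at h
  have hi : i = i' := add_left_cancel (congrArg Heisenberg.x h)
  subst hi
  have hj : j = j' := add_left_cancel (congrArg Heisenberg.y h)
  subst hj
  exact ⟨rfl, rfl, add_left_cancel (congrArg Heisenberg.z h)⟩

theorem polyPerm_injective (h3 : 3 < p) {a b c i j k i' j' k' : ZMod p}
    (h : polyPerm h3 a b c i j k = polyPerm h3 a b c i' j' k') :
    i = i' ∧ j = j' ∧ k = k' :=
  polyPerm_exponents_eq h3 (g := 1) (by rw [h])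

theorem exists_polyPerm_apply_eq (h3 : 3 < p) (a b c : ZMod p) (g h : Heisenberg p) :
    ∃ i j k, polyPerm h3 a b c i j k g = h := by
  let v := polyAct a b c (h.x - g.x) 0 0 g
  let w := polyAct a b c (h.x - g.x) (h.y - v.y) 0 g
  refine ⟨h.x - g.x, h.y - v.y, h.z - w.z, ?_⟩
  change polyAct _ _ _ _ _ _ _ = _
  ext
  · simp [polyAct]
  · simp [polyAct, v]
  · simp only [polyAct, w]; ring

theorem polyPerm_pow_σ (h3 : 3 < p) (a b c : ZMod p) (n : ℕ) :
    polyPerm h3 a b c 1 0 0 ^ n = polyPerm h3 a b c n 0 0 := by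
  induction n with
  | zero => simp [polyPerm_zero]
  | succ n ih => rw [pow_succ, ih, polyPerm_mul]; simp

theorem polyPerm_pow_τ (h3 : 3 < p) (a b c : ZMod p) (n : ℕ) :
    polyPerm h3 a b c 0 1 0 ^ n = polyPerm h3 a b c 0 n 0 := by
  induction n with
  | zero => simp [polyPerm_zero]
  | succ n ih => rw [pow_succ, ih, polyPerm_mul]; simp

theorem polyPerm_pow_ρ (h3 : 3 < p) (a b c : ZMod p) (n : ℕ) :
    polyPerm h3 a b c 0 0 1 ^ n = polyPerm h3 a b c 0 0 n := by
  induction n with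
  | zero => simp [polyPerm_zero]
  | succ n ih => rw [pow_succ, ih, polyPerm_mul]; simp

/-- The permutations `polyPerm h3 a b c i j k` form a subgroup. -/
def polySubgroup (h3 : 3 < p) (a b c : ZMod p) : Subgroup (Equiv.Perm (Heisenberg p)) where
  carrier := {π | ∃ i j k, polyPerm h3 a b c i j k = π}
  mul_mem' := by
    rintro _ _ ⟨i, j, k, rfl⟩ ⟨i', j', k', rfl⟩
    exact ⟨_, _, _, (polyPerm_mul ..).symm⟩
  one_mem' := ⟨0, 0, 0, polyPerm_zero h3 a b c⟩
  inv_mem' := by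
    rintro _ ⟨i, j, k, rfl⟩
    exact ⟨_, _, _, (polyPerm_inv ..).symm⟩

theorem closure_polyPerm (h3 : 3 < p) (a b c : ZMod p) :
    Subgroup.closure {polyPerm h3 a b c 0 0 1, polyPerm h3 a b c 0 1 0, polyPerm h3 a b c 1 0 0} =
      polySubgroup h3 a b c := by
  apply le_antisymm
  · rw [Subgroup.closure_le]
    rintro _ (rfl | rfl | rfl) <;> exact ⟨_, _, _, rfl⟩
  · rintro _ ⟨i, j, k, rfl⟩
    have h : polyPerm h3 a b c i j k = polyPerm h3 a b c 0 0 1 ^ k.val *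
        polyPerm h3 a b c 0 1 0 ^ j.val * polyPerm h3 a b c 1 0 0 ^ i.val := by
      simp [polyPerm_pow_σ, polyPerm_pow_τ, polyPerm_pow_ρ, polyPerm_mul]
    rw [h]
    exact mul_mem (mul_mem (pow_mem (Subgroup.subset_closure (by simp)) _)
      (pow_mem (Subgroup.subset_closure (by simp)) _))
      (pow_mem (Subgroup.subset_closure (by simp)) _)

theorem leftMulHom_ρ_eq (h3 : 3 < p) (a b c : ZMod p) :
    leftMulHom p ρ = polyPerm h3 a b c 0 0 1 := by
  ext g : 1
  change ρ * g = polyAct _ _ _ _ _ _ g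
  ext <;> simp [polyAct, ρ, add_comm]

theorem leftMulHom_τ_eq (h3 : 3 < p) (a b c : ZMod p) :
    leftMulHom p τ = polyPerm h3 a b c 0 1 0 := by
  ext g : 1
  change τ * g = polyAct _ _ _ _ _ _ g
  ext <;> simp [polyAct, τ, add_comm]

theorem leftMulHom_σ_mul_eq (h3 : 3 < p) (hp : p ≠ 2) (a b c : ℕ) :
    leftMulHom p σ * MulAut.toPerm (Heisenberg p) (α₁ ^ a * α₂ p hp ^ b * α₃ ^ c) =
      polyPerm h3 a b c 1 0 0 := by
  have h2 := two_ne_zero_of_three_lt h3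
  have h3' := three_ne_zero_of_three_lt h3
  have h6 : (6 : ZMod p) = 2 * 3 := by norm_num
  ext g : 1
  change σ * ((α₁ ^ a) ((α₂ p hp ^ b) ((α₃ ^ c) g))) = polyAct _ _ _ _ _ _ g
  rw [α₃_pow_apply, α₂_pow_apply, α₁_pow_apply]
  ext
  · simp [polyAct, σ, add_comm]
  · simp [polyAct, σ, add_comm]
  · simp only [polyAct, σ, mul_z, h6]; field_simp; ring

theorem isRegularSub_polySubgroup (h3 : 3 < p) (a b c : ZMod p) :
    IsRegularSub (polySubgroup h3 a b c) := by
  intro g h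
  obtain ⟨i, j, k, e⟩ := exists_polyPerm_apply_eq h3 a b c g h
  refine ⟨_, ⟨⟨i, j, k, rfl⟩, e⟩, ?_⟩
  rintro _ ⟨⟨i', j', k', rfl⟩, e'⟩
  obtain ⟨rfl, rfl, rfl⟩ := polyPerm_exponents_eq h3 (e'.trans e.symm)
  rfl

theorem card_polySubgroup (h3 : 3 < p) (a b c : ZMod p) :
    Nat.card (polySubgroup h3 a b c) = p ^ 3 := by
  let f : ZMod p × ZMod p × ZMod p → polySubgroup h3 a b c :=
    fun v => ⟨polyPerm h3 a b c v.1 v.2.1 v.2.2, _, _, _, rfl⟩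
  have hf : Function.Bijective f := by
    constructor
    · rintro ⟨i, j, k⟩ ⟨i', j', k'⟩ h
      obtain ⟨hi, hj, hk⟩ := polyPerm_injective h3 (congrArg Subtype.val h)
      exact Prod.ext hi (Prod.ext hj hk)
    · rintro ⟨_, i, j, k, rfl⟩
      exact ⟨(i, j, k), rfl⟩
  rw [← Nat.card_congr (Equiv.ofBijective f hf)]
  simp only [Nat.card_prod, Nat.card_zmod]
  ring

theorem polySubgroup_comm_iff (h3 : 3 < p) (a b c : ZMod p) :
    (∀ g ∈ polySubgroup h3 a b c, ∀ h ∈ polySubgroup h3 a b c, g * h = h * g) ↔ c = 1 := by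
  constructor
  · intro H
    have h := H (polyPerm h3 a b c 1 0 0) ⟨_, _, _, rfl⟩ (polyPerm h3 a b c 0 1 0) ⟨_, _, _, rfl⟩
    rw [polyPerm_mul, polyPerm_mul] at h
    have := (polyPerm_injective h3 h).2.2
    simpa [sub_eq_zero] using this
  · rintro rfl _ ⟨i, j, k, rfl⟩ _ ⟨i', j', k', rfl⟩
    rw [polyPerm_mul, polyPerm_mul]
    congr 1 <;> ring

theorem nonempty_polySubgroup_one_mulEquiv (h3 : 3 < p) (a b : ZMod p) :
    Nonempty (polySubgroup h3 a b 1 ≃* Multiplicative (ZMod p × ZMod p × ZMod p)) := by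
  let f : Multiplicative (ZMod p × ZMod p × ZMod p) →* polySubgroup h3 a b 1 := MonoidHom.mk'
    (fun v => ⟨polyPerm h3 a b 1 v.toAdd.1 v.toAdd.2.1 v.toAdd.2.2, _, _, _, rfl⟩)
    (fun v w => Subtype.ext (by simp [polyPerm_mul]))
  refine ⟨(MulEquiv.ofBijective f ⟨?_, ?_⟩).symm⟩
  · intro v w h
    obtain ⟨hi, hj, hk⟩ := polyPerm_injective h3 (congrArg Subtype.val h)
    exact Multiplicative.toAdd.injective (Prod.ext hi (Prod.ext hj hk))
  · rintro ⟨_, i, j, k, rfl⟩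
    exact ⟨Multiplicative.ofAdd (i, j, k), rfl⟩

theorem nonempty_polySubgroup_mulEquiv_heisenberg (h3 : 3 < p) (a b : ZMod p) {c : ZMod p}
    (hc : c ≠ 1) : Nonempty (polySubgroup h3 a b c ≃* Heisenberg p) := by
  have hc' : c - 1 ≠ 0 := sub_ne_zero.mpr hc
  let f : Heisenberg p →* polySubgroup h3 a b c := MonoidHom.mk'
    (fun g => ⟨polyPerm h3 a b c g.y g.x ((c - 1) * g.z), _, _, _, rfl⟩)
    (fun g h => Subtype.ext (by
      simp only [Subgroup.coe_mul, polyPerm_mul, mul_x, mul_y, mul_z]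
      congr 1
      ring))
  refine ⟨(MulEquiv.ofBijective f ⟨?_, ?_⟩).symm⟩
  · intro g h e
    obtain ⟨hi, hj, hk⟩ := polyPerm_injective h3 (congrArg Subtype.val e)
    exact Heisenberg.ext hj hi (mul_left_cancel₀ hc' hk)
  · rintro ⟨_, i, j, k, rfl⟩
    refine ⟨⟨j, i, (c - 1)⁻¹ * k⟩, Subtype.ext ?_⟩
    simp [f, mul_inv_cancel_left₀ hc']

theorem σ_mul_τ_ne : (σ * τ : Heisenberg p) ≠ τ * σ := by
  intro h
  simpa [σ, τ] using congrArg Heisenberg.z h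

end Heisenberg

/-- For `a, b, c ∈ {0, …, p−1}`, the subgroup
`G = ⟨ρ, τ, σ·α₁^a α₂^b α₃^c⟩` of `Hol(M₁)` is regular of order `p³`; it is abelian (and then
elementary abelian `≅ (ZMod p)³`) iff `c = 1`, and `G ≅ M₁` iff `c ≠ 1`. -/
theorem standard_regular_subgroup_type (p : ℕ) [Fact p.Prime] (h3 : 3 < p)
    (a b c : ℕ) (ha : a < p) (hb : b < p) (hc : c < p) :
    ∀ G : Subgroup (Equiv.Perm (Heisenberg p)),
      G = Subgroup.closure {leftMulHom p ρ, leftMulHom p τ,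
        leftMulHom p σ *
          MulAut.toPerm (Heisenberg p) (α₁ ^ a * α₂ p (by omega) ^ b * α₃ ^ c)} →
      G ≤ Hol p ∧ IsRegularSub G ∧ Nat.card G = p ^ 3 ∧
      ((∀ g ∈ G, ∀ h ∈ G, g * h = h * g) ↔ c = 1) ∧
      (Nonempty (G ≃* Multiplicative (ZMod p × ZMod p × ZMod p)) ↔ c = 1) ∧
      (Nonempty (G ≃* Heisenberg p) ↔ c ≠ 1) := by
  rintro G rfl
  have hc1 : (c : ZMod p) = 1 ↔ c = 1 := by
    rw [← Nat.cast_one, ZMod.natCast_eq_natCast_iff']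
    rw [Nat.mod_eq_of_lt hc, Nat.mod_eq_of_lt (by omega)]
  refine ⟨?_, ?_⟩
  · rw [Subgroup.closure_le]
    have hl (g : Heisenberg p) : leftMulHom p g ∈ Hol p :=
      Subgroup.mem_sup_left ⟨g, rfl⟩
    rintro _ (rfl | rfl | rfl)
    · exact hl _
    · exact hl _
    · exact mul_mem (hl _) (Subgroup.mem_sup_right ⟨_, rfl⟩)
  · rw [leftMulHom_ρ_eq h3 a b c, leftMulHom_τ_eq h3 a b c, leftMulHom_σ_mul_eq h3,
      closure_polyPerm, ne_eq, ← hc1]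
    have hcomm := polySubgroup_comm_iff h3 (a : ZMod p) b c
    refine ⟨isRegularSub_polySubgroup h3 _ _ _, card_polySubgroup .., hcomm, ⟨?_, ?_⟩, ⟨?_, ?_⟩⟩
    · rintro ⟨e⟩
      refine hcomm.1 fun g hg h hh => ?_
      have : (⟨g, hg⟩ * ⟨h, hh⟩ : polySubgroup h3 (a : ZMod p) b c) = ⟨h, hh⟩ * ⟨g, hg⟩ :=
        e.injective (by rw [map_mul, map_mul, mul_comm])
      exact congrArg Subtype.val this
    · intro h
      rw [h]
      exact nonempty_polySubgroup_one_mulEquiv ..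
    · rintro ⟨e⟩ h
      refine σ_mul_τ_ne (p := p) (e.symm.injective ?_)
      rw [map_mul, map_mul]
      exact Subtype.ext (hcomm.2 h _ (e.symm σ).2 _ (e.symm τ).2)
    · exact nonempty_polySubgroup_mulEquiv_heisenberg h3 _ _
end

section
/- Let p > 3 be prime. Among regular subgroups G of Hol(M₁) with |Θ(G)| = p, the conjugation action of Aut(M₁) has exactly 2(p−1) orbits consisting of subgroups isomorphic to M₁, and exactly 2 orbits consisting of subgroups isomorphic to the elementary abelian group (ZMod p)³. A complete set of orbit representatives is given by ⟨ρ, τ, σα₃⟩ and ⟨ρ, τ, σα₂α₃⟩ (elementary abelian), and ⟨ρ, τ, σα₁⟩, ⟨ρ, τ, σα₂⟩, ⟨ρ, τ, σα₃^{c}⟩, ⟨ρ, τ, σα₂α₃^{c}⟩ for c = 2, ..., p−1 (isomorphic to M₁). -/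
open Heisenberg

/-- `G` is a regular subgroup of `Hol(M₁)` isomorphic to `M₁` whose image under the canonical
projection `Θ : Hol(M₁) → Aut(M₁)` has cardinality `r`. -/
def condM1 (p r : ℕ) (G : Subgroup (Equiv.Perm (Heisenberg p))) : Prop :=
  G ≤ Hol p ∧ IsRegularSub G ∧ thetaCard p G = r ∧ Nonempty (G ≃* Heisenberg p)

/-- `G` is a regular subgroup of `Hol(M₁)`, elementary abelian of order `p³`, whose image under
the canonical projection `Θ : Hol(M₁) → Aut(M₁)` has cardinality `r`. -/
def condEA (p r : ℕ) (G : Subgroup (Equiv.Perm (Heisenberg p))) : Prop :=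
  G ≤ Hol p ∧ IsRegularSub G ∧ thetaCard p G = r ∧
    Nonempty (G ≃* Multiplicative (ZMod p × ZMod p × ZMod p))


/-- The subgroup `⟨ρ, τ, σβ⟩` of `Hol(M₁)` for an automorphism `β` of `M₁`. -/
def stdRep (p : ℕ) (β : MulAut (Heisenberg p)) : Subgroup (Equiv.Perm (Heisenberg p)) :=
  Subgroup.closure {leftMulHom p ρ, leftMulHom p τ,
    leftMulHom p σ * MulAut.toPerm (Heisenberg p) β}

/-- The representatives `⟨ρ, τ, σα₃⟩`, `⟨ρ, τ, σα₂α₃⟩`, `⟨ρ, τ, σα₁⟩`, `⟨ρ, τ, σα₂⟩`,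
`⟨ρ, τ, σα₃^c⟩`, `⟨ρ, τ, σα₂α₃^c⟩` (`c = 2, …, p−1`). -/
def reps11 (p : ℕ) [Fact p.Prime] (hp : p ≠ 2) : Set (Subgroup (Equiv.Perm (Heisenberg p))) :=
  {stdRep p α₃, stdRep p (α₂ p hp * α₃), stdRep p α₁, stdRep p (α₂ p hp)} ∪
    ⋃ c ∈ Set.Icc 2 (p - 1), {stdRep p (α₃ ^ c), stdRep p (α₂ p hp * α₃ ^ c)}

namespace Heisenberg

variable {p : ℕ}

/-- The underlying set of the Heisenberg group is `(ZMod p)³`. -/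
def equivProd (p : ℕ) : Heisenberg p ≃ ZMod p × ZMod p × ZMod p where
  toFun g := (g.x, g.y, g.z)
  invFun g := ⟨g.1, g.2.1, g.2.2⟩
  left_inv _ := rfl
  right_inv _ := rfl

instance [NeZero p] : Finite (Heisenberg p) := Finite.of_equiv _ (equivProd p).symm

theorem card_eq (p : ℕ) : Nat.card (Heisenberg p) = p ^ 3 := by
  rw [Nat.card_congr (equivProd p)]
  simp only [Nat.card_prod, Nat.card_zmod]
  ring

theorem rho_pow (n : ℕ) : (ρ : Heisenberg p) ^ n = ⟨0, 0, n⟩ := by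
  induction n with
  | zero => ext <;> simp
  | succ n ih => rw [pow_succ, ih]; ext <;> simp [ρ]

theorem sigma_pow (n : ℕ) : (σ : Heisenberg p) ^ n = ⟨n, 0, 0⟩ := by
  induction n with
  | zero => ext <;> simp
  | succ n ih => rw [pow_succ, ih]; ext <;> simp [σ]

theorem tau_pow (n : ℕ) : (τ : Heisenberg p) ^ n = ⟨0, n, 0⟩ := by
  induction n with
  | zero => ext <;> simp
  | succ n ih => rw [pow_succ, ih]; ext <;> simp [τ]

theorem eq_pow_mul_pow_mul_pow [NeZero p] (g : Heisenberg p) :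
    g = ρ ^ g.z.val * σ ^ g.x.val * τ ^ g.y.val := by
  rw [rho_pow, sigma_pow, tau_pow]
  ext <;> simp

/-- Additive characters of the Heisenberg group factor through the `x` and `y` coordinates. -/
theorem additive_eq [NeZero p] {f : Heisenberg p → ZMod p}
    (hf : ∀ g h, f (g * h) = f g + f h) (g : Heisenberg p) :
    f g = f σ * g.x + f τ * g.y := by
  have h1 : f 1 = 0 := by simpa using hf 1 1
  have hpow : ∀ (g : Heisenberg p) (n : ℕ), f (g ^ n) = f g * (n : ZMod p) := by
    intro g n
    induction n with
    | zero => simp [h1]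
    | succ n ih => rw [pow_succ, hf, ih]; push_cast; ring
  have hρ : f ρ = 0 := by
    have h : (τ : Heisenberg p) * σ = ρ * (σ * τ) := by ext <;> simp [ρ, σ, τ]
    have := congrArg f h
    simp only [hf] at this
    linear_combination -this
  have := congrArg f (eq_pow_mul_pow_mul_pow g)
  simp only [hf, hpow, hρ, ZMod.natCast_val, ZMod.cast_id', id_eq] at this
  linear_combination this

/-- The endomorphism of the Heisenberg group given by a linear map on the `x` and `y`
coordinates and a linear correction of the `z` coordinate. -/
def linEnd (h2 : (2 : ZMod p) * 2⁻¹ = 1) (a b c d f g : ZMod p) :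
    Heisenberg p →* Heisenberg p where
  toFun m := ⟨a * m.x + b * m.y, c * m.x + d * m.y,
    (a * d - b * c) * m.z + a * c * 2⁻¹ * m.x ^ 2 + b * d * 2⁻¹ * m.y ^ 2 + b * c * m.x * m.y
      + f * m.x + g * m.y⟩
  map_one' := by ext <;> simp
  map_mul' m n := by
    ext <;> simp
    · ring
    · ring
    · linear_combination (a * c * m.x * n.x + b * d * m.y * n.y) * h2

theorem exists_eq_linEnd [NeZero p] (h2 : (2 : ZMod p) * 2⁻¹ = 1)
    (φ : Heisenberg p →* Heisenberg p) : ∃ a b c d f g, φ = linEnd h2 a b c d f g := by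
  have hx := additive_eq (f := fun m => (φ m).x) (fun g h => by simp)
  have hy := additive_eq (f := fun m => (φ m).y) (fun g h => by simp)
  set a := (φ σ).x
  set b := (φ τ).x
  set c := (φ σ).y
  set d := (φ τ).y
  have hz := additive_eq (f := fun m => (φ m).z - (linEnd h2 a b c d 0 0 m).z) (fun g h => by
    simp only [map_mul, mul_z, hx, hy]
    simp only [linEnd, MonoidHom.coe_mk, OneHom.coe_mk]
    ring)
  refine ⟨a, b, c, d, (φ σ).z - (linEnd h2 a b c d 0 0 σ).z,
    (φ τ).z - (linEnd h2 a b c d 0 0 τ).z, MonoidHom.ext fun m => ?_⟩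
  ext
  · exact hx m
  · exact hy m
  · have := hz m
    rw [sub_eq_iff_eq_add] at this
    refine this.trans ?_
    simp only [linEnd, MonoidHom.coe_mk, OneHom.coe_mk]
    ring

theorem linEnd_injective [Fact p.Prime] (h2 : (2 : ZMod p) * 2⁻¹ = 1) {a b c d : ZMod p}
    (f g : ZMod p) (h : a * d - b * c ≠ 0) : Function.Injective (linEnd h2 a b c d f g) := by
  rw [injective_iff_map_eq_one]
  intro m hm
  have h1 : a * m.x + b * m.y = 0 := congrArg Heisenberg.x hm
  have h3 : c * m.x + d * m.y = 0 := congrArg Heisenberg.y hm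
  have h4 : (linEnd h2 a b c d f g m).z = 0 := congrArg Heisenberg.z hm
  have hx : m.x = 0 := mul_left_cancel₀ h (by linear_combination d * h1 - b * h3)
  have hy : m.y = 0 := mul_left_cancel₀ h (by linear_combination a * h3 - c * h1)
  have hz : m.z = 0 := mul_left_cancel₀ h (by simpa [linEnd, hx, hy, h] using h4)
  ext <;> assumption

/-- The automorphism of the Heisenberg group attached to an invertible matrix and a linear
correction of the `z` coordinate. -/
noncomputable def linAut [Fact p.Prime] (h2 : (2 : ZMod p) * 2⁻¹ = 1) (a b c d f g : ZMod p)
    (h : a * d - b * c ≠ 0) : MulAut (Heisenberg p) :=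
  MulEquiv.ofBijective (linEnd h2 a b c d f g)
    (Finite.injective_iff_bijective.mp (linEnd_injective h2 f g h))

theorem exists_mulAut_eq_linEnd [Fact p.Prime] (h2 : (2 : ZMod p) * 2⁻¹ = 1)
    (α : MulAut (Heisenberg p)) : ∃ a b c d f g, a * d - b * c ≠ 0 ∧
      ∀ m, α m = linEnd h2 a b c d f g m := by
  obtain ⟨a, b, c, d, f, g, h⟩ := exists_eq_linEnd h2 (α : Heisenberg p →* Heisenberg p)
  have h' : ∀ m, α m = linEnd h2 a b c d f g m := fun m => DFunLike.congr_fun h m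
  refine ⟨a, b, c, d, f, g, fun h0 => ?_, h'⟩
  have : (ρ : Heisenberg p) = 1 := α.injective (by
    rw [h', map_one]
    ext <;> simp [linEnd, ρ, h0])
  exact one_ne_zero (congrArg Heisenberg.z this)

/-- A one-parameter group `t ↦ shear κ c l t` of automorphisms preserving `⟨ρ, τ⟩`. -/
def shear (κ c l t : ZMod p) : MulAut (Heisenberg p) where
  toFun g := ⟨g.x, g.y + 2 * κ * t * g.x,
    g.z + c * t * g.y + l * t * g.x + κ * (c * t ^ 2 * g.x + t * g.x ^ 2)⟩
  invFun g := ⟨g.x, g.y - 2 * κ * t * g.x,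
    g.z - c * t * g.y - l * t * g.x + κ * (c * t ^ 2 * g.x - t * g.x ^ 2)⟩
  left_inv g := by ext <;> simp <;> ring
  right_inv g := by ext <;> simp <;> ring
  map_mul' g h := by ext <;> simp <;> ring

theorem shear_apply (κ c l t : ZMod p) (g : Heisenberg p) : shear κ c l t g = ⟨g.x,
    g.y + 2 * κ * t * g.x,
    g.z + c * t * g.y + l * t * g.x + κ * (c * t ^ 2 * g.x + t * g.x ^ 2)⟩ := rfl

theorem shear_add (κ c l s t : ZMod p) :
    shear κ c l (s + t) = shear κ c l s * shear κ c l t := by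
  ext g <;> simp [shear_apply] <;> ring

theorem shear_zero (κ c l : ZMod p) : shear κ c l 0 = 1 := by
  ext g <;> simp [shear_apply]

theorem shear_injective [Fact p.Prime] (h2 : (2 : ZMod p) ≠ 0) {κ c l : ZMod p}
    (h : ¬(κ = 0 ∧ c = 0 ∧ l = 0)) : Function.Injective (shear κ c l) := by
  intro s t hst
  have hσ := DFunLike.congr_fun hst (σ : Heisenberg p)
  have hτ := DFunLike.congr_fun hst (τ : Heisenberg p)
  simp only [shear_apply, Heisenberg.mk.injEq, σ, τ] at hσ hτ
  by_cases hκ : κ = 0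
  · by_cases hc : c = 0
    · have hl : l ≠ 0 := fun hl => h ⟨hκ, hc, hl⟩
      simpa [hκ, hc, hl] using hσ
    · simpa [hc] using hτ
  · simpa [hκ, h2] using hσ.2.1

end Heisenberg

section Holomorph

variable {p : ℕ}

/-- The element `m · β` of the holomorph. -/
def holElt (m : Heisenberg p) (β : MulAut (Heisenberg p)) : Equiv.Perm (Heisenberg p) :=
  leftMulHom p m * MulAut.toPerm (Heisenberg p) β

theorem holElt_apply (m : Heisenberg p) (β : MulAut (Heisenberg p)) (h : Heisenberg p) :
    holElt m β h = m * β h := rfl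

theorem holElt_mul (m n : Heisenberg p) (α β : MulAut (Heisenberg p)) :
    holElt m α * holElt n β = holElt (m * α n) (α * β) := by
  ext1 h
  simp [holElt_apply, mul_assoc]

theorem holElt_one : holElt (1 : Heisenberg p) 1 = 1 := by
  ext1 h
  simp [holElt_apply]

theorem holElt_inv (m : Heisenberg p) (α : MulAut (Heisenberg p)) :
    (holElt m α)⁻¹ = holElt (α⁻¹ m⁻¹) α⁻¹ := by
  rw [inv_eq_iff_mul_eq_one, holElt_mul, mul_inv_cancel, MulAut.apply_inv_self, mul_inv_cancel,
    holElt_one]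

theorem holElt_one_right (m : Heisenberg p) : holElt m 1 = leftMulHom p m := by
  simp [holElt]

theorem toPerm_eq_holElt (α : MulAut (Heisenberg p)) :
    MulAut.toPerm (Heisenberg p) α = holElt 1 α := by
  simp [holElt]

theorem holElt_mem_Hol (m : Heisenberg p) (β : MulAut (Heisenberg p)) : holElt m β ∈ Hol p :=
  mul_mem (Subgroup.mem_sup_left ⟨m, rfl⟩) (Subgroup.mem_sup_right ⟨β, rfl⟩)

theorem mem_Hol_iff {π : Equiv.Perm (Heisenberg p)} : π ∈ Hol p ↔ ∃ m β, π = holElt m β := by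
  refine ⟨fun h => ?_, fun ⟨m, β, h⟩ => h ▸ holElt_mem_Hol m β⟩
  let K : Subgroup (Equiv.Perm (Heisenberg p)) :=
    { carrier := {π | ∃ m β, π = holElt m β}
      one_mem' := ⟨1, 1, holElt_one.symm⟩
      mul_mem' := by
        rintro _ _ ⟨m, α, rfl⟩ ⟨n, β, rfl⟩
        exact ⟨_, _, holElt_mul ..⟩
      inv_mem' := by
        rintro _ ⟨m, α, rfl⟩
        exact ⟨_, _, holElt_inv ..⟩ }
  have hK : Hol p ≤ K := by
    refine sup_le ?_ ?_
    · rintro _ ⟨m, rfl⟩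
      exact ⟨m, 1, (holElt_one_right m).symm⟩
    · rintro _ ⟨α, rfl⟩
      exact ⟨1, α, toPerm_eq_holElt α⟩
  exact hK h

theorem theta_holElt (m : Heisenberg p) (β : MulAut (Heisenberg p)) :
    theta p (holElt m β) = MulAut.toPerm (Heisenberg p) β := by
  ext1 h
  simp [theta, holElt_apply]
  rfl

/-- The restriction of the canonical projection to a subgroup of the holomorph. -/
def thetaHom {G : Subgroup (Equiv.Perm (Heisenberg p))} (hG : G ≤ Hol p) :
    G →* Equiv.Perm (Heisenberg p) :=
  MonoidHom.mk' (fun g => theta p g) fun g h => by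
    obtain ⟨m, α, hg⟩ := mem_Hol_iff.mp (hG g.2)
    obtain ⟨n, β, hh⟩ := mem_Hol_iff.mp (hG h.2)
    rw [Subgroup.coe_mul, hg, hh, holElt_mul, theta_holElt, theta_holElt, theta_holElt, map_mul]

theorem card_range_thetaHom {G : Subgroup (Equiv.Perm (Heisenberg p))} (hG : G ≤ Hol p) :
    Nat.card (thetaHom hG).range = thetaCard p G := by
  unfold thetaCard
  rw [Set.image_eq_range]
  rfl

theorem card_of_isRegularSub {X : Type*} [Nonempty X] {G : Subgroup (Equiv.Perm X)}
    (hG : IsRegularSub G) : Nat.card G = Nat.card X := by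
  obtain ⟨x⟩ := ‹Nonempty X›
  refine Nat.card_congr (Equiv.ofBijective (fun g : G => g.1 x) ⟨fun g h hgh => ?_, fun y => ?_⟩)
  · exact Subtype.ext ((hG x (h.1 x)).unique ⟨g.2, hgh⟩ ⟨h.2, rfl⟩)
  · obtain ⟨g, hg, -⟩ := hG x y
    exact ⟨⟨g, hg.1⟩, hg.2⟩

theorem IsRegularSub.eq_of_le {X : Type*} [Nonempty X] {G K : Subgroup (Equiv.Perm X)}
    (hG : IsRegularSub G) (hK : IsRegularSub K) (h : G ≤ K) : G = K := by
  obtain ⟨x⟩ := ‹Nonempty X›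
  refine le_antisymm h fun k hk => ?_
  obtain ⟨g, hg, -⟩ := hG x (k x)
  exact (hK x (k x)).unique ⟨h hg.1, hg.2⟩ ⟨hk, rfl⟩ ▸ hg.1

theorem autConj_one (G : Subgroup (Equiv.Perm (Heisenberg p))) : autConj p 1 G = G := by
  ext g
  simp [autConj]

theorem autConj_mul (α β : MulAut (Heisenberg p)) (G : Subgroup (Equiv.Perm (Heisenberg p))) :
    autConj p (α * β) G = autConj p α (autConj p β G) := by
  simp only [autConj, Subgroup.map_map]
  congr 1

theorem autConj_inv_autConj (α : MulAut (Heisenberg p))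
    (G : Subgroup (Equiv.Perm (Heisenberg p))) : autConj p α⁻¹ (autConj p α G) = G := by
  rw [← autConj_mul, inv_mul_cancel, autConj_one]

/-- Conjugate subgroups are isomorphic. -/
noncomputable def autConjEquiv (α : MulAut (Heisenberg p))
    (G : Subgroup (Equiv.Perm (Heisenberg p))) : G ≃* autConj p α G :=
  G.equivMapOfInjective _ (MulEquiv.injective _)

theorem conj_holElt (α β : MulAut (Heisenberg p)) (m : Heisenberg p) :
    MulAut.conj (MulAut.toPerm (Heisenberg p) α) (holElt m β) =
      holElt (α m) (α * β * α⁻¹) := by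
  rw [MulAut.conj_apply, ← map_inv, toPerm_eq_holElt, toPerm_eq_holElt, holElt_mul, holElt_mul]
  simp

theorem autConj_le_Hol (α : MulAut (Heisenberg p)) {G : Subgroup (Equiv.Perm (Heisenberg p))}
    (hG : G ≤ Hol p) : autConj p α G ≤ Hol p := by
  rintro _ ⟨g, hg, rfl⟩
  obtain ⟨m, β, rfl⟩ := mem_Hol_iff.mp (hG hg)
  exact mem_Hol_iff.mpr ⟨_, _, conj_holElt α β m⟩

theorem isRegularSub_autConj (α : MulAut (Heisenberg p))
    {G : Subgroup (Equiv.Perm (Heisenberg p))} (hG : IsRegularSub G) :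
    IsRegularSub (autConj p α G) := by
  intro x y
  obtain ⟨g, ⟨hg, hgx⟩, hu⟩ := hG (α⁻¹ x) (α⁻¹ y)
  refine ⟨_, ⟨⟨g, hg, rfl⟩, ?_⟩, ?_⟩
  · change α (g (α⁻¹ x)) = y
    rw [hgx, MulAut.apply_inv_self]
  · rintro _ ⟨⟨h, hh, rfl⟩, hhx⟩
    replace hhx : α (h (α⁻¹ x)) = y := hhx
    rw [hu h ⟨hh, by rw [← hhx, MulAut.inv_apply_self]⟩]

theorem thetaCard_autConj (α : MulAut (Heisenberg p))
    {G : Subgroup (Equiv.Perm (Heisenberg p))} (hG : G ≤ Hol p) :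
    thetaCard p (autConj p α G) = thetaCard p G := by
  unfold thetaCard
  rw [← Nat.card_image_of_injective
    (MulAut.conj (MulAut.toPerm (Heisenberg p) α)).injective (theta p '' (G : Set _))]
  congr 2
  rw [autConj, Subgroup.coe_map, Set.image_image, Set.image_image]
  refine Set.image_congr fun g hg => ?_
  obtain ⟨m, β, rfl⟩ := mem_Hol_iff.mp (hG hg)
  change theta p (MulAut.conj _ _) = MulAut.conj _ _
  rw [conj_holElt, theta_holElt, theta_holElt, map_mul, map_mul, map_inv, MulAut.conj_apply]

theorem toPerm_injective : Function.Injective (MulAut.toPerm (Heisenberg p)) := fun _ _ h =>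
  MulEquiv.ext fun m => DFunLike.congr_fun h m

theorem mulAut_pow_card_eq_one {G : Subgroup (Equiv.Perm (Heisenberg p))} (hG : G ≤ Hol p)
    (hcard : thetaCard p G = p) {m : Heisenberg p} {β : MulAut (Heisenberg p)}
    (h : holElt m β ∈ G) : β ^ p = 1 := by
  have h1 := pow_card_eq_one' (x := (thetaHom hG).rangeRestrict ⟨_, h⟩)
  rw [card_range_thetaHom, hcard] at h1
  replace h1 : theta p (holElt m β) ^ p = 1 := congrArg Subtype.val h1
  rw [theta_holElt, ← map_pow, ← map_one (MulAut.toPerm (Heisenberg p))] at h1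
  exact toPerm_injective h1

end Holomorph

section ShearSubgroup

variable {p : ℕ}

theorem holElt_shear_mul (κ c l : ZMod p) (m n : Heisenberg p) :
    holElt m (shear κ c l m.x) * holElt n (shear κ c l n.x) =
      holElt (m * shear κ c l m.x n) (shear κ c l (m * shear κ c l m.x n).x) := by
  rw [holElt_mul, ← shear_add]
  rfl

/-- The regular subgroup of the holomorph consisting of the elements `m · shear κ c l m.x`. -/
def shearSubgroup (κ c l : ZMod p) : Subgroup (Equiv.Perm (Heisenberg p)) where
  carrier := Set.range fun m : Heisenberg p => holElt m (shear κ c l m.x)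
  one_mem' := ⟨1, by simp [shear_zero, holElt_one]⟩
  mul_mem' := by
    rintro _ _ ⟨m, rfl⟩ ⟨n, rfl⟩
    exact ⟨_, (holElt_shear_mul ..).symm⟩
  inv_mem' := by
    rintro _ ⟨m, rfl⟩
    refine ⟨(shear κ c l (-m.x)) m⁻¹, ?_⟩
    have h : shear κ c l (-m.x) = (shear κ c l m.x)⁻¹ := by
      rw [eq_inv_iff_mul_eq_one, ← shear_add, neg_add_cancel, shear_zero]
    simp only [holElt_inv, ← h]
    rfl

theorem mem_shearSubgroup {κ c l : ZMod p} {g : Equiv.Perm (Heisenberg p)} :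
    g ∈ shearSubgroup κ c l ↔ ∃ m : Heisenberg p, holElt m (shear κ c l m.x) = g := Iff.rfl

theorem shearSubgroup_le_Hol (κ c l : ZMod p) : shearSubgroup κ c l ≤ Hol p := by
  rintro _ ⟨m, rfl⟩
  exact holElt_mem_Hol _ _

theorem isRegularSub_shearSubgroup (κ c l : ZMod p) : IsRegularSub (shearSubgroup κ c l) := by
  intro g h
  have hx : (h * (shear κ c l (h.x - g.x) g)⁻¹).x = h.x - g.x := by
    simp [shear_apply, sub_eq_add_neg]
  refine ⟨_, ⟨⟨h * (shear κ c l (h.x - g.x) g)⁻¹, rfl⟩, ?_⟩, ?_⟩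
  · simp only [hx, holElt_apply, inv_mul_cancel_right]
  · rintro _ ⟨⟨m, rfl⟩, hm⟩
    simp only [holElt_apply] at hm
    have hmx : m.x = h.x - g.x := by
      rw [← hm]
      simp [shear_apply]
    have : h * (shear κ c l (h.x - g.x) g)⁻¹ = m := by
      rw [← hmx, ← hm, mul_inv_cancel_right]
    rw [this]

theorem leftMulHom_mem_shearSubgroup (κ c l : ZMod p) {m : Heisenberg p} (hm : m.x = 0) :
    leftMulHom p m ∈ shearSubgroup κ c l :=
  ⟨m, by simp only [hm, shear_zero, holElt_one_right]⟩

theorem pow_holElt_shear_apply_one_x (κ c l : ZMod p) (n : ℕ) :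
    ((holElt σ (shear κ c l 1) ^ n) 1).x = n := by
  induction n with
  | zero => simp
  | succ n ih =>
    rw [pow_succ', Equiv.Perm.mul_apply, holElt_apply, mul_x, shear_apply, ih]
    simp [σ, add_comm]

theorem stdRep_shear [NeZero p] (κ c l : ZMod p) :
    stdRep p (shear κ c l 1) = shearSubgroup κ c l := by
  have hσ : holElt σ (shear κ c l 1) ∈ shearSubgroup κ c l := ⟨σ, rfl⟩
  refine le_antisymm ?_ ?_
  · rw [stdRep, Subgroup.closure_le]
    rintro g (rfl | rfl | rfl)
    · exact leftMulHom_mem_shearSubgroup κ c l rfl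
    · exact leftMulHom_mem_shearSubgroup κ c l rfl
    · exact hσ
  · intro g hg
    have hρS : leftMulHom p ρ ∈ stdRep p (shear κ c l 1) := Subgroup.subset_closure (by simp)
    have hτS : leftMulHom p τ ∈ stdRep p (shear κ c l 1) := Subgroup.subset_closure (by simp)
    have hσS : holElt σ (shear κ c l 1) ∈ stdRep p (shear κ c l 1) :=
      Subgroup.subset_closure (by simp [holElt])
    set s := holElt σ (shear κ c l 1) ^ (g 1).x.val with hs
    obtain ⟨m, hm⟩ := mem_shearSubgroup.mp (mul_mem hg (inv_mem (pow_mem hσ (g 1).x.val)))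
    have hmx : m.x = 0 := by
      have h := congrArg Heisenberg.x (DFunLike.congr_fun hm (s 1))
      rw [← hs, ← Equiv.Perm.mul_apply (g * s⁻¹), inv_mul_cancel_right, holElt_apply, mul_x,
        shear_apply] at h
      simpa [hs, pow_holElt_shear_apply_one_x] using h
    have hg' : g = leftMulHom p m * s := by
      rw [← inv_mul_cancel_right g s, hs, ← hm, hmx, shear_zero, holElt_one_right]
    have hm' := eq_pow_mul_pow_mul_pow m
    rw [hmx, ZMod.val_zero, pow_zero, mul_one] at hm'
    rw [hg', hm', map_mul, map_pow, map_pow]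
    exact mul_mem (mul_mem (pow_mem hρS _) (pow_mem hτS _)) (pow_mem hσS _)

theorem theta_image_shearSubgroup (κ c l : ZMod p) :
    theta p '' (shearSubgroup κ c l : Set (Equiv.Perm (Heisenberg p))) =
      Set.range fun t => MulAut.toPerm (Heisenberg p) (shear κ c l t) := by
  ext g
  constructor
  · rintro ⟨_, ⟨m, rfl⟩, rfl⟩
    exact ⟨m.x, (theta_holElt ..).symm⟩
  · rintro ⟨t, rfl⟩
    exact ⟨_, ⟨⟨t, 0, 0⟩, rfl⟩, theta_holElt ..⟩

theorem thetaCard_shearSubgroup [Fact p.Prime] (h2 : (2 : ZMod p) ≠ 0) {κ c l : ZMod p}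
    (h : ¬(κ = 0 ∧ c = 0 ∧ l = 0)) : thetaCard p (shearSubgroup κ c l) = p := by
  rw [thetaCard, theta_image_shearSubgroup, Nat.card_range_of_injective, Nat.card_zmod]
  exact toPerm_injective.comp (shear_injective h2 h)

theorem shear_zero_zero_zero (t : ZMod p) : shear 0 0 0 t = 1 := by
  ext g <;> simp [shear_apply]

theorem thetaCard_shearSubgroup_zero : thetaCard p (shearSubgroup (0 : ZMod p) 0 0) = 1 := by
  rw [thetaCard, theta_image_shearSubgroup]
  simp [shear_zero_zero_zero]

/-- For `c ≠ 1` the group `shearSubgroup κ c l` is a Heisenberg group. -/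
theorem nonempty_shearSubgroup_mulEquiv_heisenberg [Fact p.Prime] (h2 : (2 : ZMod p) ≠ 0)
    (h3 : (3 : ZMod p) ≠ 0) (κ l : ZMod p) {c : ZMod p} (hc : c ≠ 1) :
    Nonempty (shearSubgroup κ c l ≃* Heisenberg p) := by
  let e : Heisenberg p → Heisenberg p := fun g => ⟨g.x, g.y + κ * g.x ^ 2,
    (1 - c) * g.z + c * g.x * g.y + l / 2 * g.x ^ 2 + κ * (c + 1) / 3 * g.x ^ 3⟩
  have he : ∀ g h, e (g * h) = e g * shear κ c l (e g).x (e h) := by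
    intro g h
    ext
    · simp [e, shear_apply]
    · simp [e, shear_apply]
      ring
    · simp [e, shear_apply]
      field_simp
      ring
  have hc' : 1 - c ≠ 0 := sub_ne_zero.mpr hc.symm
  have hbij : Function.Bijective e := by
    rw [← Finite.injective_iff_bijective]
    intro g h hgh
    simp only [e, Heisenberg.mk.injEq] at hgh
    obtain ⟨hx, hy, hz⟩ := hgh
    rw [hx, add_left_inj] at hy
    rw [hx, hy, add_left_inj, add_left_inj, add_left_inj] at hz
    exact Heisenberg.ext hx hy (mul_left_cancel₀ hc' hz)
  let ψ : Heisenberg p →* shearSubgroup κ c l :=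
    MonoidHom.mk' (fun g => ⟨holElt (e g) (shear κ c l (e g).x), e g, rfl⟩) fun g h =>
      Subtype.ext (by rw [Subgroup.coe_mul, holElt_shear_mul, he])
  refine ⟨(MulEquiv.ofBijective ψ ⟨fun g h hgh => ?_, ?_⟩).symm⟩
  · have := DFunLike.congr_fun (congrArg Subtype.val hgh) (1 : Heisenberg p)
    exact hbij.1 (by simpa [ψ, holElt_apply] using this)
  · rintro ⟨_, m, rfl⟩
    obtain ⟨g, rfl⟩ := hbij.2 m
    exact ⟨g, rfl⟩

/-- The group `shearSubgroup κ 1 l` is elementary abelian. -/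
theorem nonempty_shearSubgroup_mulEquiv_prod [Fact p.Prime] (h2 : (2 : ZMod p) ≠ 0)
    (h3 : (3 : ZMod p) ≠ 0) (κ l : ZMod p) :
    Nonempty (shearSubgroup κ 1 l ≃* Multiplicative (ZMod p × ZMod p × ZMod p)) := by
  let e : ZMod p × ZMod p × ZMod p → Heisenberg p := fun g => ⟨g.1, g.2.1 + κ * g.1 ^ 2,
    g.2.2 + g.1 * g.2.1 + l / 2 * g.1 ^ 2 + κ * 2 / 3 * g.1 ^ 3⟩
  have he : ∀ g h, e (g + h) = e g * shear κ 1 l (e g).x (e h) := by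
    intro g h
    ext
    · simp [e, shear_apply]
    · simp [e, shear_apply]
      ring
    · simp [e, shear_apply]
      field_simp
      ring
  have hinj : Function.Injective e := by
    intro g h hgh
    simp only [e, Heisenberg.mk.injEq] at hgh
    obtain ⟨hx, hy, hz⟩ := hgh
    rw [hx, add_left_inj] at hy
    rw [hx, hy, add_left_inj, add_left_inj, add_left_inj] at hz
    exact Prod.ext hx (Prod.ext hy hz)
  let ψ : Multiplicative (ZMod p × ZMod p × ZMod p) →* shearSubgroup κ 1 l :=
    MonoidHom.mk' (fun g => ⟨holElt (e g.toAdd) (shear κ 1 l (e g.toAdd).x), e g.toAdd, rfl⟩)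
      fun g h => Subtype.ext (by rw [Subgroup.coe_mul, holElt_shear_mul, toAdd_mul, he])
  have hψ : Function.Injective ψ := fun g h hgh => by
    have := DFunLike.congr_fun (congrArg Subtype.val hgh) (1 : Heisenberg p)
    exact Multiplicative.toAdd.injective (hinj (by simpa [ψ, holElt_apply] using this))
  refine ⟨(MulEquiv.ofBijective ψ ((Nat.bijective_iff_injective_and_card ψ).mpr
    ⟨hψ, ?_⟩)).symm⟩
  rw [card_of_isRegularSub (isRegularSub_shearSubgroup κ 1 l), Nat.card_congr (equivProd p)]
  rfl

theorem isEmpty_heisenberg_mulEquiv_prod [Fact p.Prime] :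
    IsEmpty (Heisenberg p ≃* Multiplicative (ZMod p × ZMod p × ZMod p)) := by
  refine ⟨fun e => ?_⟩
  have h : (σ : Heisenberg p) * τ = τ * σ :=
    e.injective (by rw [map_mul, map_mul, mul_comm])
  simpa [σ, τ] using congrArg Heisenberg.z h

/-- Lower triangular automorphisms permute the groups `shearSubgroup κ c l`. -/
theorem autConj_shearSubgroup [Fact p.Prime] (h2 : (2 : ZMod p) * 2⁻¹ = 1)
    {a e d f g κ c l κ' l' : ZMod p} (h : a * d - 0 * e ≠ 0) (hκ : κ' * a ^ 2 = d * κ)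
    (hl : l' * a ^ 2 = a * d * l + 2 * g * κ - c * a * e) :
    autConj p (linAut h2 a 0 e d f g h) (shearSubgroup κ c l) = shearSubgroup κ' c l' := by
  refine IsRegularSub.eq_of_le (isRegularSub_autConj _ (isRegularSub_shearSubgroup κ c l))
    (isRegularSub_shearSubgroup κ' c l') ?_
  have key : ∀ (t : ZMod p) (n : Heisenberg p), linEnd h2 a 0 e d f g (shear κ c l t n) =
      shear κ' c l' (a * t) (linEnd h2 a 0 e d f g n) := by
    intro t n
    ext
    · simp [linEnd, shear_apply]
    · simp only [linEnd, shear_apply, MonoidHom.coe_mk, OneHom.coe_mk]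
      linear_combination -2 * t * n.x * hκ
    · simp only [linEnd, shear_apply, MonoidHom.coe_mk, OneHom.coe_mk]
      linear_combination -t * n.x * hl - (c * t ^ 2 * a * n.x + t * a * n.x ^ 2) * hκ
  rintro _ ⟨_, ⟨m, rfl⟩, rfl⟩
  refine ⟨linEnd h2 a 0 e d f g m, ?_⟩
  change _ = MulAut.conj _ (holElt _ _)
  rw [conj_holElt]
  have hx : (linEnd h2 a 0 e d f g m).x = a * m.x := by simp [linEnd]
  have : shear κ' c l' (a * m.x) = linAut h2 a 0 e d f g h * shear κ c l m.x *
      (linAut h2 a 0 e d f g h)⁻¹ := by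
    rw [eq_mul_inv_iff_mul_eq]
    exact MulEquiv.ext fun n => (key m.x n).symm
  simp only [hx, this]
  rfl

/-- The invariants of `shearSubgroup κ c l` under conjugation by automorphisms. -/
theorem eq_and_iff_of_autConj_shearSubgroup_eq [Fact p.Prime] (h2 : (2 : ZMod p) ≠ 0)
    {α : MulAut (Heisenberg p)} {κ c l κ' c' l' : ZMod p} (h0 : ¬(κ' = 0 ∧ c' = 0 ∧ l' = 0))
    (h : autConj p α (shearSubgroup κ c l) = shearSubgroup κ' c' l') :
    c = c' ∧ (κ = 0 ↔ κ' = 0) := by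
  have key : ∀ m n : Heisenberg p, α (shear κ c l m.x n) = shear κ' c' l' (α m).x (α n) := by
    intro m n
    have hm : MulAut.conj (MulAut.toPerm (Heisenberg p) α) (holElt m (shear κ c l m.x)) ∈
        shearSubgroup κ' c' l' := h ▸ ⟨_, ⟨m, rfl⟩, rfl⟩
    rw [conj_holElt] at hm
    obtain ⟨m', hm'⟩ := hm
    have h1 := DFunLike.congr_fun hm' (1 : Heisenberg p)
    simp only [holElt_apply, map_one, mul_one] at h1
    subst h1
    have := DFunLike.congr_fun hm' (α n)
    simpa [holElt_apply] using this.symm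
  obtain ⟨a, b, e, d, f, g, hdet, hα⟩ := exists_mulAut_eq_linEnd (mul_inv_cancel₀ h2) α
  simp only [hα] at key
  have hb : b = 0 := by
    refine shear_injective h2 h0 (MulEquiv.ext fun n => ?_)
    obtain ⟨n, rfl⟩ := α.surjective n
    have := key τ n
    simp only [τ, shear_zero, MulAut.one_apply, linEnd, MonoidHom.coe_mk, OneHom.coe_mk, mul_zero,
      zero_add, mul_one] at this
    rw [hα, shear_zero, MulAut.one_apply]
    exact this.symm
  subst hb
  simp only [zero_mul, sub_zero, ne_eq, mul_eq_zero, not_or] at hdet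
  obtain ⟨ha, hd⟩ := hdet
  constructor
  · have := congrArg Heisenberg.z (key σ τ)
    simp [linEnd, shear_apply, σ, τ] at this
    refine mul_left_cancel₀ (mul_ne_zero ha hd) ?_
    linear_combination this
  · have := congrArg Heisenberg.y (key σ σ)
    simp [linEnd, shear_apply, σ] at this
    have h' : d * κ = κ' * a ^ 2 := mul_left_cancel₀ h2 (by linear_combination this)
    constructor
    · rintro rfl
      simpa [ha] using h'.symm
    · rintro rfl
      simpa [hd] using h'

end ShearSubgroup

section Classification

variable {p : ℕ} [Fact p.Prime] {G : Subgroup (Equiv.Perm (Heisenberg p))}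

theorem index_comap_leftMulHom (hG : G ≤ Hol p) (hreg : IsRegularSub G)
    (hcard : thetaCard p G = p) : (G.comap (leftMulHom p)).index = p := by
  have hker : Nat.card (G.comap (leftMulHom p)) = Nat.card (thetaHom hG).ker := by
    refine Nat.card_congr (Equiv.ofBijective (fun n => ⟨⟨leftMulHom p n.1, n.2⟩, ?_⟩) ⟨?_, ?_⟩)
    · change theta p (leftMulHom p n.1) = 1
      rw [← holElt_one_right, theta_holElt, map_one]
    · intro n n' h
      have := DFunLike.congr_fun (congrArg (fun g => g.1.1) h) (1 : Heisenberg p)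
      simp only [← holElt_one_right, holElt_apply, map_one, mul_one] at this
      exact Subtype.ext this
    · rintro ⟨⟨g, hg⟩, h⟩
      obtain ⟨m, β, rfl⟩ := mem_Hol_iff.mp (hG hg)
      replace h : theta p (holElt m β) = 1 := h
      rw [theta_holElt, ← map_one (MulAut.toPerm (Heisenberg p))] at h
      obtain rfl := toPerm_injective h
      rw [holElt_one_right] at hg
      exact ⟨⟨m, hg⟩, Subtype.ext (Subtype.ext (holElt_one_right m).symm)⟩
  have h1 := (thetaHom hG).ker.card_mul_index
  rw [Subgroup.index_ker, card_range_thetaHom, hcard, card_of_isRegularSub hreg, ← hker,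
    ← (G.comap (leftMulHom p)).card_mul_index] at h1
  exact (Nat.eq_of_mul_eq_mul_left Nat.card_pos h1).symm

/-- Up to conjugation, the translations in `G` contain `⟨ρ, τ⟩`. -/
theorem exists_autConj_leftMulHom_mem (h2 : (2 : ZMod p) ≠ 0) (hG : G ≤ Hol p)
    (hreg : IsRegularSub G) (hcard : thetaCard p G = p) :
    ∃ γ : MulAut (Heisenberg p), ∀ m : Heisenberg p, m.x = 0 →
      leftMulHom p m ∈ autConj p γ G := by
  have hidx := index_comap_leftMulHom hG hreg hcard
  set N := G.comap (leftMulHom p)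
  have hnormal : N.Normal := Subgroup.normal_of_index_eq_minFac_card (by
    rw [hidx, card_eq, (Fact.out : p.Prime).pow_minFac (by norm_num)])
  have hquot : Nat.card (Heisenberg p ⧸ N) = p := hidx
  let e : Heisenberg p ⧸ N ≃* Multiplicative (ZMod p) :=
    mulEquivOfPrimeCardEq hquot (Nat.card_zmod p)
  let φ : Heisenberg p → ZMod p := fun m => (e (QuotientGroup.mk m)).toAdd
  have hφ := additive_eq (f := φ) (fun g h => by simp [φ])
  have hmem : ∀ n, φ n = 0 → n ∈ N := by
    intro n hn
    rw [← QuotientGroup.eq_one_iff]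
    exact e.injective (by rw [map_one]; exact hn)
  have hne : ¬(φ σ = 0 ∧ φ τ = 0) := by
    rintro ⟨hu, hv⟩
    have : N = ⊤ := by
      rw [eq_top_iff]
      intro n _
      exact hmem n (by rw [hφ, hu, hv]; ring)
    rw [this, Subgroup.index_top] at hidx
    exact (Fact.out : p.Prime).one_lt.ne hidx
  obtain ⟨c, d, hdet⟩ : ∃ c d, φ σ * d - φ τ * c ≠ 0 := by
    by_cases hu : φ σ = 0
    · exact ⟨1, 0, by simpa [hu] using hne⟩
    · exact ⟨0, 1, by simpa using hu⟩
  refine ⟨linAut (mul_inv_cancel₀ h2) _ _ c d 0 0 hdet, fun m hm => ?_⟩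
  set γ := linAut (mul_inv_cancel₀ h2) _ _ c d 0 0 hdet
  obtain ⟨n, rfl⟩ := γ.surjective m
  refine ⟨leftMulHom p n, hmem n ((hφ n).trans hm), ?_⟩
  change MulAut.conj _ _ = _
  rw [← holElt_one_right, conj_holElt, mul_one, mul_inv_cancel, holElt_one_right]

theorem x_eq_zero_of_leftMulHom_mem (hreg : IsRegularSub G) (hcard : thetaCard p G = p)
    (hN : ∀ m : Heisenberg p, m.x = 0 → leftMulHom p m ∈ G) {n : Heisenberg p}
    (hn : leftMulHom p n ∈ G) : n.x = 0 := by
  by_contra hx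
  have hpow : ∀ k : ℕ, (n ^ k).x = k * n.x := by
    intro k
    induction k with
    | zero => simp
    | succ k ih => rw [pow_succ, mul_x, ih]; push_cast; ring
  have hall : ∀ m : Heisenberg p, leftMulHom p m ∈ G := by
    intro m
    rw [← inv_mul_cancel_right m (n ^ (m.x / n.x).val), map_mul, map_pow]
    refine mul_mem (hN _ ?_) (pow_mem hn _)
    rw [mul_x, inv_x, hpow, ZMod.natCast_zmod_val, div_mul_cancel₀ _ hx, add_neg_cancel]
  have : shearSubgroup (0 : ZMod p) 0 0 = G := by
    refine IsRegularSub.eq_of_le (isRegularSub_shearSubgroup 0 0 0) hreg ?_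
    rintro _ ⟨m, rfl⟩
    simpa only [shear_zero_zero_zero, holElt_one_right] using hall m
  rw [← this, thetaCard_shearSubgroup_zero] at hcard
  exact (Fact.out : p.Prime).one_lt.ne hcard

theorem exists_eq_shearSubgroup (h2 : (2 : ZMod p) ≠ 0) (hG : G ≤ Hol p)
    (hreg : IsRegularSub G) (hcard : thetaCard p G = p)
    (hN : ∀ m : Heisenberg p, m.x = 0 → leftMulHom p m ∈ G) :
    ∃ κ c l, ¬(κ = 0 ∧ c = 0 ∧ l = 0) ∧ G = shearSubgroup κ c l := by
  obtain ⟨π, ⟨hπ, hπσ⟩, -⟩ := hreg 1 σ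
  obtain ⟨m, β, rfl⟩ := mem_Hol_iff.mp (hG hπ)
  obtain rfl : m = σ := by simpa [holElt_apply] using hπσ
  obtain ⟨a, b, c, d, f, g, -, hβ⟩ := exists_mulAut_eq_linEnd (mul_inv_cancel₀ h2) β
  have hb : b = 0 := by
    have h := mul_mem (mul_mem hπ (hN τ rfl)) (inv_mem hπ)
    rw [← holElt_one_right, holElt_inv, holElt_mul, holElt_mul, mul_one, mul_inv_cancel,
      MulAut.apply_inv_self, holElt_one_right] at h
    have := x_eq_zero_of_leftMulHom_mem hreg hcard hN h
    simpa [hβ, linEnd, σ, τ] using this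
  subst hb
  have hβp := mulAut_pow_card_eq_one hG hcard hπ
  have hx : ∀ n : ℕ, ((β ^ n) σ).x = a ^ n := by
    intro n
    induction n with
    | zero => simp [σ]
    | succ n ih => rw [pow_succ', MulAut.mul_apply, hβ]; simp [linEnd, ih, pow_succ']
  have hy : ∀ n : ℕ, ((β ^ n) τ).x = 0 ∧ ((β ^ n) τ).y = d ^ n := by
    intro n
    induction n with
    | zero => simp [τ]
    | succ n ih => rw [pow_succ', MulAut.mul_apply, hβ]; simp [linEnd, ih, pow_succ']
  obtain rfl : a = 1 := by simpa [hβp, σ, eq_comm] using hx p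
  obtain rfl : d = 1 := by simpa [hβp, τ, eq_comm] using (hy p).2
  have hshear : β = shear (c * 2⁻¹) g (f - c * 2⁻¹ * g) 1 := by
    refine MulEquiv.ext fun n => ?_
    rw [hβ]
    ext
    · simp [linEnd, shear_apply]
    · simp [linEnd, shear_apply]
      field_simp
      ring
    · simp [linEnd, shear_apply]
      ring
  have heq : shearSubgroup (c * 2⁻¹) g (f - c * 2⁻¹ * g) = G := by
    refine IsRegularSub.eq_of_le (isRegularSub_shearSubgroup _ _ _) hreg ?_
    rw [← stdRep_shear, ← hshear, stdRep, Subgroup.closure_le]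
    rintro _ (rfl | rfl | rfl)
    · exact hN _ rfl
    · exact hN _ rfl
    · exact hπ
  refine ⟨_, _, _, ?_, heq.symm⟩
  rintro ⟨h1, h3, h4⟩
  rw [← heq, h4, h1, h3, thetaCard_shearSubgroup_zero] at hcard
  exact (Fact.out : p.Prime).one_lt.ne hcard

/-- The chosen representatives of the conjugacy classes of the groups `shearSubgroup κ c l`. -/
def normalForm (c : ZMod p) (b : Bool) : Subgroup (Equiv.Perm (Heisenberg p)) :=
  shearSubgroup (if b then 2⁻¹ else 0) c (if b then -(1 + c) / 2 else if c = 0 then 1 else 0)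

theorem normalForm_params_ne_zero (h2 : (2 : ZMod p) ≠ 0) (c : ZMod p) (b : Bool) :
    ¬((if b then 2⁻¹ else 0 : ZMod p) = 0 ∧ c = 0 ∧
      (if b then -(1 + c) / 2 else if c = 0 then 1 else 0) = 0) := by
  rintro ⟨h, rfl, h'⟩
  cases b <;> simp_all

theorem thetaCard_normalForm (h2 : (2 : ZMod p) ≠ 0) (c : ZMod p) (b : Bool) :
    thetaCard p (normalForm c b) = p :=
  thetaCard_shearSubgroup h2 (normalForm_params_ne_zero h2 c b)

theorem normalForm_inj (h2 : (2 : ZMod p) ≠ 0) {c c' : ZMod p} {b b' : Bool}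
    {α : MulAut (Heisenberg p)} (h : autConj p α (normalForm c b) = normalForm c' b') :
    c = c' ∧ b = b' := by
  obtain ⟨hc, hκ⟩ :=
    eq_and_iff_of_autConj_shearSubgroup_eq h2 (normalForm_params_ne_zero h2 c' b') h
  refine ⟨hc, ?_⟩
  cases b <;> cases b' <;> simp_all

theorem exists_autConj_shearSubgroup_eq_normalForm (h2 : (2 : ZMod p) ≠ 0) {κ c l : ZMod p}
    (h : ¬(κ = 0 ∧ c = 0 ∧ l = 0)) :
    ∃ α b, autConj p α (shearSubgroup κ c l) = normalForm c b := by
  have hi := mul_inv_cancel₀ h2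
  by_cases hκ : κ = 0
  · subst hκ
    by_cases hc : c = 0
    · subst hc
      have hl : l ≠ 0 := by simpa using h
      refine ⟨_, false, autConj_shearSubgroup (a := 1) (d := l⁻¹) (e := 0) (f := 0) (g := 0)
        hi (by simpa using hl) ?_ ?_⟩ <;> simp [hl]
    · refine ⟨_, false, autConj_shearSubgroup (a := 1) (d := 1) (e := l / c) (f := 0) (g := 0)
        hi (by simp) ?_ ?_⟩
      · simp
      · simp [hc]
        field_simp
        ring
  · refine ⟨_, true, autConj_shearSubgroup (a := 1) (d := (2 * κ)⁻¹) (e := 0) (f := 0)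
        (g := (-(1 + c) / 2 - (2 * κ)⁻¹ * l) / (2 * κ)) hi (by simp [hκ, h2]) ?_ ?_⟩
    · simp
      field_simp
    · simp
      field_simp
      ring

theorem exists_autConj_eq_normalForm (h2 : (2 : ZMod p) ≠ 0) (hG : G ≤ Hol p)
    (hreg : IsRegularSub G) (hcard : thetaCard p G = p) :
    ∃ α c b, autConj p α G = normalForm c b := by
  obtain ⟨γ, hγ⟩ := exists_autConj_leftMulHom_mem h2 hG hreg hcard
  obtain ⟨κ, c, l, h0, h⟩ := exists_eq_shearSubgroup h2 (autConj_le_Hol γ hG)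
    (isRegularSub_autConj γ hreg) ((thetaCard_autConj γ hG).trans hcard) hγ
  obtain ⟨α, b, hα⟩ := exists_autConj_shearSubgroup_eq_normalForm h2 h0
  exact ⟨α * γ, c, b, by rw [autConj_mul, h, hα]⟩

theorem condEA_normalForm (h2 : (2 : ZMod p) ≠ 0) (h3 : (3 : ZMod p) ≠ 0) (b : Bool) :
    condEA p p (normalForm 1 b) :=
  ⟨shearSubgroup_le_Hol _ _ _, isRegularSub_shearSubgroup _ _ _, thetaCard_normalForm h2 1 b,
    nonempty_shearSubgroup_mulEquiv_prod h2 h3 _ _⟩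

theorem condM1_normalForm (h2 : (2 : ZMod p) ≠ 0) (h3 : (3 : ZMod p) ≠ 0) {c : ZMod p}
    (hc : c ≠ 1) (b : Bool) : condM1 p p (normalForm c b) :=
  ⟨shearSubgroup_le_Hol _ _ _, isRegularSub_shearSubgroup _ _ _, thetaCard_normalForm h2 c b,
    nonempty_shearSubgroup_mulEquiv_heisenberg h2 h3 _ _ hc⟩

theorem condEA.exists_autConj_eq (h2 : (2 : ZMod p) ≠ 0) (h3 : (3 : ZMod p) ≠ 0)
    (h : condEA p p G) : ∃ b α, autConj p α G = normalForm 1 b := by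
  obtain ⟨hG, hreg, hcard, ⟨e⟩⟩ := h
  obtain ⟨α, c, b, hα⟩ := exists_autConj_eq_normalForm h2 hG hreg hcard
  by_cases hc : c = 1
  · exact ⟨b, α, hc ▸ hα⟩
  · obtain ⟨-, -, -, ⟨e'⟩⟩ := condM1_normalForm h2 h3 hc b
    rw [← hα] at e'
    exact isEmpty_heisenberg_mulEquiv_prod.elim
      (e'.symm.trans ((autConjEquiv α G).symm.trans e))

theorem condM1.exists_autConj_eq (h2 : (2 : ZMod p) ≠ 0) (h3 : (3 : ZMod p) ≠ 0)
    (h : condM1 p p G) : ∃ c b α, c ≠ 1 ∧ autConj p α G = normalForm c b := by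
  obtain ⟨hG, hreg, hcard, ⟨e⟩⟩ := h
  obtain ⟨α, c, b, hα⟩ := exists_autConj_eq_normalForm h2 hG hreg hcard
  refine ⟨c, b, α, ?_, hα⟩
  rintro rfl
  obtain ⟨-, -, -, ⟨e'⟩⟩ := condEA_normalForm h2 h3 b
  rw [← hα] at e'
  exact isEmpty_heisenberg_mulEquiv_prod.elim (e.symm.trans ((autConjEquiv α G).trans e'))

theorem alpha₃_pow (c : ℕ) : (α₃ : MulAut (Heisenberg p)) ^ c = shear 0 c 0 1 := by
  induction c with
  | zero => ext <;> simp [shear_apply]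
  | succ c ih =>
    rw [pow_succ', ih]
    ext <;> simp [shear_apply, α₃]
    ring

theorem alpha₂_mul_alpha₃_pow (h2 : (2 : ZMod p) ≠ 0) (hp : p ≠ 2) (c : ℕ) :
    α₂ p hp * α₃ ^ c = shear 2⁻¹ (c : ZMod p) (-(1 + (c : ZMod p)) / 2) 1 := by
  rw [alpha₃_pow]
  ext g
  · simp [shear_apply, α₂]
  · simp [shear_apply, α₂, h2, add_comm]
  · simp [shear_apply, α₂]
    field_simp
    ring

theorem stdRep_alpha₃_pow {c : ℕ} (hc : (c : ZMod p) ≠ 0) :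
    stdRep p (α₃ ^ c) = normalForm (c : ZMod p) false := by
  rw [alpha₃_pow, stdRep_shear]
  simp [normalForm, hc]

theorem stdRep_alpha₂_mul_alpha₃_pow (h2 : (2 : ZMod p) ≠ 0) (hp : p ≠ 2) (c : ℕ) :
    stdRep p (α₂ p hp * α₃ ^ c) = normalForm (c : ZMod p) true := by
  rw [alpha₂_mul_alpha₃_pow h2, stdRep_shear]
  rfl

theorem stdRep_alpha₁ : stdRep p α₁ = normalForm (0 : ZMod p) false := by
  have : (α₁ : MulAut (Heisenberg p)) = shear 0 0 1 1 := by
    ext <;> simp [shear_apply, α₁]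
  rw [this, stdRep_shear]
  simp [normalForm]

end Classification

theorem Nat.card_quot_of_representatives {ι X : Type*} {r : X → X → Prop} (hr : Equivalence r)
    (f : ι → X) (hinj : ∀ i j, r (f i) (f j) → i = j) (hsurj : ∀ x, ∃ i, r x (f i)) :
    Nat.card (Quot r) = Nat.card ι := by
  refine (Nat.card_congr (Equiv.ofBijective (fun i => Quot.mk r (f i)) ⟨fun i j h => ?_, ?_⟩)).symm
  · exact hinj i j ((hr.quot_mk_eq_iff _ _).mp h)
  · rintro ⟨x⟩
    obtain ⟨i, hi⟩ := hsurj x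
    exact ⟨i, (Quot.sound hi).symm⟩

theorem equivalence_autConj (p : ℕ) (P : Subgroup (Equiv.Perm (Heisenberg p)) → Prop) :
    Equivalence fun G G' : {G // P G} => ∃ α : MulAut (Heisenberg p), autConj p α G.1 = G'.1 where
  refl G := ⟨1, autConj_one _⟩
  symm := fun ⟨α, h⟩ => ⟨α⁻¹, by rw [← h, autConj_inv_autConj]⟩
  trans := fun ⟨α, h⟩ ⟨β, h'⟩ => ⟨β * α, by rw [autConj_mul, h, h']⟩

/-- Among regular subgroups `G` of `Hol(M₁)` with `|Θ(G)| = p` there are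
exactly `2(p−1)` conjugacy orbits of type `M₁` and exactly `2` of elementary abelian type, with
the explicit complete set of pairwise non-conjugate orbit representatives described above. -/
theorem orbits_theta_p (p : ℕ) [Fact p.Prime] (h3 : 3 < p) :
    Nat.card (Quot (fun (G G' : {G : Subgroup (Equiv.Perm (Heisenberg p)) // condM1 p p G}) =>
      ∃ α : MulAut (Heisenberg p), autConj p α G.1 = G'.1)) = 2 * (p - 1) ∧
    Nat.card (Quot (fun (G G' : {G : Subgroup (Equiv.Perm (Heisenberg p)) // condEA p p G}) =>
      ∃ α : MulAut (Heisenberg p), autConj p α G.1 = G'.1)) = 2 ∧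
    condEA p p (stdRep p α₃) ∧ condEA p p (stdRep p (α₂ p (by omega) * α₃)) ∧
    condM1 p p (stdRep p α₁) ∧ condM1 p p (stdRep p (α₂ p (by omega))) ∧
    (∀ c : ℕ, 2 ≤ c → c ≤ p - 1 →
      condM1 p p (stdRep p (α₃ ^ c)) ∧ condM1 p p (stdRep p (α₂ p (by omega) * α₃ ^ c))) ∧
    (∀ G, condEA p p G → ∃ α : MulAut (Heisenberg p),
      autConj p α G = stdRep p α₃ ∨ autConj p α G = stdRep p (α₂ p (by omega) * α₃)) ∧
    (∀ G, condM1 p p G → ∃ α : MulAut (Heisenberg p),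
      autConj p α G = stdRep p α₁ ∨ autConj p α G = stdRep p (α₂ p (by omega)) ∨
      ∃ c : ℕ, 2 ≤ c ∧ c ≤ p - 1 ∧
        (autConj p α G = stdRep p (α₃ ^ c) ∨
          autConj p α G = stdRep p (α₂ p (by omega) * α₃ ^ c))) ∧
    (∀ R ∈ reps11 p (by omega), ∀ R' ∈ reps11 p (by omega),
      (∃ α : MulAut (Heisenberg p), autConj p α R = R') → R = R') := by
  have hp : p ≠ 2 := by omega
  have natCast_ne : ∀ a b : ℕ, a < p → b < p → a ≠ b → (a : ZMod p) ≠ b := by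
    intro a b ha hb hab h
    rw [ZMod.natCast_eq_natCast_iff', Nat.mod_eq_of_lt ha, Nat.mod_eq_of_lt hb] at h
    exact hab h
  have two_ne : (2 : ZMod p) ≠ 0 := by
    exact_mod_cast natCast_ne 2 0 (by omega) (by omega) (by omega)
  have three_ne : (3 : ZMod p) ≠ 0 := by
    exact_mod_cast natCast_ne 3 0 (by omega) (by omega) (by omega)
  have zero_ne_one' : (0 : ZMod p) ≠ 1 := zero_ne_one
  have cast_ne_zero : ∀ c : ℕ, 2 ≤ c → c ≤ p - 1 → (c : ZMod p) ≠ 0 := fun c h h' => by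
    exact_mod_cast natCast_ne c 0 (by omega) (by omega) (by omega)
  have cast_ne_one : ∀ c : ℕ, 2 ≤ c → c ≤ p - 1 → (c : ZMod p) ≠ 1 := fun c h h' => by
    exact_mod_cast natCast_ne c 1 (by omega) (by omega) (by omega)
  have e₃ : stdRep p α₃ = normalForm (1 : ZMod p) false := by
    simpa using stdRep_alpha₃_pow (p := p) (c := 1) (by simp)
  have e₂₃ : stdRep p (α₂ p hp * α₃) = normalForm (1 : ZMod p) true := by
    simpa using stdRep_alpha₂_mul_alpha₃_pow two_ne hp 1
  have e₂ : stdRep p (α₂ p hp) = normalForm (0 : ZMod p) true := by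
    simpa using stdRep_alpha₂_mul_alpha₃_pow two_ne hp 0
  have e₃c : ∀ c : ℕ, 2 ≤ c → c ≤ p - 1 →
      stdRep p (α₃ ^ c) = normalForm (c : ZMod p) false := fun c h h' =>
    stdRep_alpha₃_pow (cast_ne_zero c h h')
  have e₂₃c := stdRep_alpha₂_mul_alpha₃_pow two_ne hp
  refine ⟨?_, ?_, ?_, ?_, ?_, ?_, fun c h h' => ⟨?_, ?_⟩, ?_, ?_, ?_⟩
  · rw [Nat.card_quot_of_representatives (ι := {c : ZMod p // c ≠ 1} × Bool)
      (equivalence_autConj p (condM1 p p))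
      (fun i => ⟨normalForm i.1.1 i.2, condM1_normalForm two_ne three_ne i.1.2 i.2⟩)]
    · simp [Nat.card_eq_fintype_card, Fintype.card_subtype_compl, ZMod.card, mul_comm]
    · rintro ⟨⟨c, hc⟩, b⟩ ⟨⟨c', hc'⟩, b'⟩ ⟨α, h⟩
      obtain ⟨rfl, rfl⟩ := normalForm_inj two_ne h
      rfl
    · rintro ⟨G, hG⟩
      obtain ⟨c, b, α, hc, h⟩ := hG.exists_autConj_eq two_ne three_ne
      exact ⟨⟨⟨c, hc⟩, b⟩, α, h⟩
  · rw [Nat.card_quot_of_representatives (ι := Bool) (equivalence_autConj p (condEA p p))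
      (fun b => ⟨normalForm 1 b, condEA_normalForm two_ne three_ne b⟩)]
    · simp
    · rintro b b' ⟨α, h⟩
      exact (normalForm_inj two_ne h).2
    · rintro ⟨G, hG⟩
      exact hG.exists_autConj_eq two_ne three_ne
  · exact e₃ ▸ condEA_normalForm two_ne three_ne _
  · exact e₂₃ ▸ condEA_normalForm two_ne three_ne _
  · exact stdRep_alpha₁ (p := p) ▸ condM1_normalForm two_ne three_ne zero_ne_one' _
  · exact e₂ ▸ condM1_normalForm two_ne three_ne zero_ne_one' _
  · exact e₃c c h h' ▸ condM1_normalForm two_ne three_ne (cast_ne_one c h h') _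
  · exact e₂₃c c ▸ condM1_normalForm two_ne three_ne (cast_ne_one c h h') _
  · intro G hG
    obtain ⟨b, α, h⟩ := hG.exists_autConj_eq two_ne three_ne
    refine ⟨α, ?_⟩
    rw [e₃, e₂₃, h]
    cases b <;> simp
  · intro G hG
    obtain ⟨c, b, α, hc, h⟩ := hG.exists_autConj_eq two_ne three_ne
    refine ⟨α, ?_⟩
    by_cases hc0 : c = 0
    · rw [stdRep_alpha₁, e₂, h, hc0]
      cases b <;> simp
    · have hv : ((c.val : ℕ) : ZMod p) = c := ZMod.natCast_zmod_val c
      have hlt := ZMod.val_lt c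
      have h0 : c.val ≠ 0 := fun h0 => hc0 (by rw [← hv, h0, Nat.cast_zero])
      have h1 : c.val ≠ 1 := fun h1 => hc (by rw [← hv, h1, Nat.cast_one])
      refine Or.inr (Or.inr ⟨c.val, by omega, by omega, ?_⟩)
      rw [e₃c _ (by omega) (by omega), e₂₃c, hv, h]
      cases b <;> simp
  · have hreps : ∀ R ∈ reps11 p hp, ∃ c b, R = normalForm (c : ZMod p) b := by
      intro R hR
      simp only [reps11, Set.mem_union, Set.mem_insert_iff, Set.mem_singleton_iff, Set.mem_iUnion,
        Set.mem_Icc, exists_prop] at hR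
      rcases hR with (rfl | rfl | rfl | rfl) | ⟨c, ⟨h, h'⟩, rfl | rfl⟩
      · exact ⟨_, _, e₃⟩
      · exact ⟨_, _, e₂₃⟩
      · exact ⟨_, _, stdRep_alpha₁⟩
      · exact ⟨_, _, e₂⟩
      · exact ⟨_, _, e₃c c h h'⟩
      · exact ⟨_, _, e₂₃c c⟩
    intro R hR R' hR' ⟨α, h⟩
    obtain ⟨c, b, rfl⟩ := hreps R hR
    obtain ⟨c', b', rfl⟩ := hreps R' hR'
    obtain ⟨rfl, rfl⟩ := normalForm_inj two_ne h
    rfl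
end

section
/- Let p > 3 be prime and let u₂, u₃, v₂, v₃ ∈ {0, 1, ..., p−1}. Set u = σ^{u₂}τ^{u₃} and v = σ^{v₂}τ^{v₃} in M₁. Then the subgroup G = ⟨ρ, u·α₁, v·α₃⟩ of Hol(M₁) has order p³; G acts regularly on M₁ if and only if u₂v₃ − u₃v₂ ≢ 0 (mod p); and G is abelian if and only if v₂ ≡ u₃ + u₂v₃ − u₃v₂ (mod p). -/
open Heisenberg

namespace Heisenberg

variable {p : ℕ}

theorem σ_pow_mul_τ_pow (m n : ℕ) : (σ : Heisenberg p) ^ m * τ ^ n = ⟨m, n, 0⟩ := by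
  have hσ : (σ : Heisenberg p) ^ m = ⟨m, 0, 0⟩ := by
    induction m with
    | zero => ext <;> simp
    | succ m ih => rw [pow_succ, ih]; ext <;> simp [σ]
  have hτ : (τ : Heisenberg p) ^ n = ⟨0, n, 0⟩ := by
    induction n with
    | zero => ext <;> simp
    | succ n ih => rw [pow_succ, ih]; ext <;> simp [τ]
  rw [hσ, hτ]
  ext <;> simp

/-- The bilinear form describing the composition of the permutations `affinePerm`. -/
def affineForm (u₂ u₃ v₂ v₃ a' b' a b : ZMod p) : ZMod p :=
  (a' + u₃ * a' + v₃ * b') * (u₂ * a + v₂ * b) + b' * (u₃ * a + v₃ * b)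

/-- The permutation of `Heisenberg p` with automorphism part `α₁ ^ a * α₃ ^ b` and translation part
`(u₂ * a + v₂ * b, u₃ * a + v₃ * b, c)`. -/
def affinePerm (u₂ u₃ v₂ v₃ a b c : ZMod p) : Equiv.Perm (Heisenberg p) where
  toFun g := ⟨g.x + (u₂ * a + v₂ * b), g.y + (u₃ * a + v₃ * b),
    g.z + c + (a + u₃ * a + v₃ * b) * g.x + b * g.y⟩
  invFun g := ⟨g.x - (u₂ * a + v₂ * b), g.y - (u₃ * a + v₃ * b),
    g.z - c - (a + u₃ * a + v₃ * b) * (g.x - (u₂ * a + v₂ * b)) -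
      b * (g.y - (u₃ * a + v₃ * b))⟩
  left_inv g := by ext <;> simp; ring
  right_inv g := by ext <;> simp; ring

variable (u₂ u₃ v₂ v₃ : ZMod p)

@[simp] theorem affinePerm_apply (a b c : ZMod p) (g : Heisenberg p) :
    affinePerm u₂ u₃ v₂ v₃ a b c g = ⟨g.x + (u₂ * a + v₂ * b), g.y + (u₃ * a + v₃ * b),
      g.z + c + (a + u₃ * a + v₃ * b) * g.x + b * g.y⟩ := rfl

theorem affinePerm_mul (a' b' c' a b c : ZMod p) :
    affinePerm u₂ u₃ v₂ v₃ a' b' c' * affinePerm u₂ u₃ v₂ v₃ a b c =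
      affinePerm u₂ u₃ v₂ v₃ (a' + a) (b' + b)
        (c' + c + affineForm u₂ u₃ v₂ v₃ a' b' a b) := by
  ext g <;> simp [affineForm] <;> ring

theorem affinePerm_zero : affinePerm u₂ u₃ v₂ v₃ 0 0 0 = 1 := by
  ext g <;> simp

theorem affinePerm_inv (a b c : ZMod p) :
    (affinePerm u₂ u₃ v₂ v₃ a b c)⁻¹ =
      affinePerm u₂ u₃ v₂ v₃ (-a) (-b) (affineForm u₂ u₃ v₂ v₃ a b a b - c) := by
  rw [inv_eq_iff_mul_eq_one, affinePerm_mul, ← affinePerm_zero u₂ u₃ v₂ v₃]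
  congr 1
  · ring
  · ring
  · simp only [affineForm]
    ring

theorem affinePerm_injective {a b c a' b' c' : ZMod p}
    (h : affinePerm u₂ u₃ v₂ v₃ a b c = affinePerm u₂ u₃ v₂ v₃ a' b' c') :
    a = a' ∧ b = b' ∧ c = c' := by
  have h₀ := DFunLike.congr_fun h ⟨0, 0, 0⟩
  have hx := DFunLike.congr_fun h ⟨1, 0, 0⟩
  have hy := DFunLike.congr_fun h ⟨0, 1, 0⟩
  simp only [affinePerm_apply, Heisenberg.mk.injEq] at h₀ hx hy
  obtain ⟨-, h₁, h₂⟩ := h₀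
  have hc : c = c' := by linear_combination h₂
  have hb : b = b' := by linear_combination hy.2.2 - hc
  exact ⟨by linear_combination hx.2.2 - hc - h₁, hb, hc⟩

/-- The subgroup of all `affinePerm u₂ u₃ v₂ v₃ a b c`. -/
def affineSubgroup : Subgroup (Equiv.Perm (Heisenberg p)) where
  carrier := {π | ∃ a b c, affinePerm u₂ u₃ v₂ v₃ a b c = π}
  one_mem' := ⟨0, 0, 0, affinePerm_zero ..⟩
  mul_mem' := by
    rintro _ _ ⟨a', b', c', rfl⟩ ⟨a, b, c, rfl⟩
    exact ⟨_, _, _, (affinePerm_mul ..).symm⟩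
  inv_mem' := by
    rintro _ ⟨a, b, c, rfl⟩
    exact ⟨_, _, _, (affinePerm_inv ..).symm⟩

theorem card_affineSubgroup : Nat.card (affineSubgroup u₂ u₃ v₂ v₃) = p ^ 3 := by
  let f : ZMod p × ZMod p × ZMod p → affineSubgroup u₂ u₃ v₂ v₃ := fun t =>
    ⟨affinePerm u₂ u₃ v₂ v₃ t.1 t.2.1 t.2.2, _, _, _, rfl⟩
  have hf : Function.Bijective f := by
    refine ⟨fun s t h => ?_, ?_⟩
    · obtain ⟨h₁, h₂, h₃⟩ := affinePerm_injective _ _ _ _ (congrArg Subtype.val h)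
      exact Prod.ext h₁ (Prod.ext h₂ h₃)
    · rintro ⟨_, a, b, c, rfl⟩
      exact ⟨(a, b, c), rfl⟩
  rw [← Nat.card_congr (Equiv.ofBijective f hf), Nat.card_prod, Nat.card_prod, Nat.card_zmod]
  ring

theorem affinePerm_pow (a b c : ZMod p) (n : ℕ) :
    ∃ d, affinePerm u₂ u₃ v₂ v₃ a b c ^ n = affinePerm u₂ u₃ v₂ v₃ (n * a) (n * b) d := by
  induction n with
  | zero => exact ⟨0, by simp [affinePerm_zero]⟩
  | succ n ih =>
    obtain ⟨d, hd⟩ := ih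
    refine ⟨d + c + affineForm u₂ u₃ v₂ v₃ (n * a) (n * b) a b, ?_⟩
    rw [pow_succ, hd, affinePerm_mul]
    push_cast
    rw [add_one_mul, add_one_mul]

theorem affinePerm_central_pow (n : ℕ) :
    affinePerm u₂ u₃ v₂ v₃ 0 0 1 ^ n = affinePerm u₂ u₃ v₂ v₃ 0 0 n := by
  induction n with
  | zero => simp [affinePerm_zero]
  | succ n ih => rw [pow_succ, ih, affinePerm_mul]; simp [affineForm]

theorem closure_affinePerm [NeZero p] :
    Subgroup.closure {affinePerm u₂ u₃ v₂ v₃ 0 0 1, affinePerm u₂ u₃ v₂ v₃ 1 0 0,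
      affinePerm u₂ u₃ v₂ v₃ 0 1 0} = affineSubgroup u₂ u₃ v₂ v₃ := by
  apply le_antisymm
  · rw [Subgroup.closure_le]
    rintro _ (rfl | rfl | rfl) <;> exact ⟨_, _, _, rfl⟩
  · rintro _ ⟨a, b, c, rfl⟩
    obtain ⟨d, hd⟩ := affinePerm_pow u₂ u₃ v₂ v₃ 1 0 0 a.val
    obtain ⟨e, he⟩ := affinePerm_pow u₂ u₃ v₂ v₃ 0 1 0 b.val
    have key : affinePerm u₂ u₃ v₂ v₃ a b c =
        affinePerm u₂ u₃ v₂ v₃ 0 0 1 ^ (c - d - e - affineForm u₂ u₃ v₂ v₃ a 0 0 b).val *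
          (affinePerm u₂ u₃ v₂ v₃ 1 0 0 ^ a.val * affinePerm u₂ u₃ v₂ v₃ 0 1 0 ^ b.val) := by
      rw [affinePerm_central_pow, hd, he, affinePerm_mul, affinePerm_mul]
      simp only [ZMod.natCast_zmod_val]
      congr 1 <;> simp [affineForm]
    rw [key]
    refine mul_mem (pow_mem (Subgroup.subset_closure ?_) _)
      (mul_mem (pow_mem (Subgroup.subset_closure ?_) _)
        (pow_mem (Subgroup.subset_closure ?_) _)) <;> simp

theorem isRegularSub_affineSubgroup_iff [Fact p.Prime] :
    IsRegularSub (affineSubgroup u₂ u₃ v₂ v₃) ↔ u₂ * v₃ - u₃ * v₂ ≠ 0 := by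
  constructor
  · intro hreg hdet
    obtain ⟨a, b, hne, h₁, h₂⟩ : ∃ a b : ZMod p, ¬(a = 0 ∧ b = 0) ∧
        u₂ * a + v₂ * b = 0 ∧ u₃ * a + v₃ * b = 0 := by
      by_cases h : v₂ = 0 ∧ u₂ = 0
      · obtain ⟨rfl, rfl⟩ := h
        by_cases h' : v₃ = 0 ∧ u₃ = 0
        · exact ⟨1, 0, by simp, by simp, by simp [h'.2]⟩
        · exact ⟨v₃, -u₃, by simpa using h', by simp, by ring⟩
      · exact ⟨v₂, -u₂, by simpa using h, by ring, by linear_combination -hdet⟩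
    have hfix : affinePerm u₂ u₃ v₂ v₃ a b 0 1 = 1 := by ext <;> simp [h₁, h₂]
    have := (hreg 1 1).unique ⟨⟨a, b, 0, rfl⟩, hfix⟩ ⟨one_mem _, rfl⟩
    rw [← affinePerm_zero u₂ u₃ v₂ v₃] at this
    obtain ⟨ha, hb, -⟩ := affinePerm_injective _ _ _ _ this
    exact hne ⟨ha, hb⟩
  · intro hdet g h
    have hinv := mul_inv_cancel₀ hdet
    set D := u₂ * v₃ - u₃ * v₂
    let a := D⁻¹ * (v₃ * (h.x - g.x) - v₂ * (h.y - g.y))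
    let b := D⁻¹ * (u₂ * (h.y - g.y) - u₃ * (h.x - g.x))
    refine ⟨affinePerm u₂ u₃ v₂ v₃ a b
      (h.z - g.z - (a + u₃ * a + v₃ * b) * g.x - b * g.y), ⟨⟨_, _, _, rfl⟩, ?_⟩, ?_⟩
    · ext
      · simp only [affinePerm_apply, a, b]
        linear_combination (h.x - g.x) * hinv
      · simp only [affinePerm_apply, a, b]
        linear_combination (h.y - g.y) * hinv
      · simp only [affinePerm_apply]
        ring
    · rintro _ ⟨⟨a', b', c', rfl⟩, rfl⟩
      have ha : a = a' := by
        simp only [affinePerm_apply, a]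
        linear_combination a' * hinv
      have hb : b = b' := by
        simp only [affinePerm_apply, b]
        linear_combination b' * hinv
      rw [ha, hb]
      congr 1
      simp only [affinePerm_apply]
      ring

theorem affineSubgroup_commutative_iff :
    (∀ g ∈ affineSubgroup u₂ u₃ v₂ v₃, ∀ h ∈ affineSubgroup u₂ u₃ v₂ v₃, g * h = h * g) ↔
      v₂ = u₃ + u₂ * v₃ - u₃ * v₂ := by
  constructor
  · intro hcomm
    have h := hcomm _ ⟨1, 0, 0, rfl⟩ _ ⟨0, 1, 0, rfl⟩
    rw [affinePerm_mul, affinePerm_mul] at h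
    have hc := (affinePerm_injective _ _ _ _ h).2.2
    simp only [affineForm] at hc
    linear_combination hc
  · rintro h _ ⟨a, b, c, rfl⟩ _ ⟨a', b', c', rfl⟩
    rw [affinePerm_mul, affinePerm_mul]
    congr 1
    · ring
    · ring
    · simp only [affineForm]
      linear_combination (a * b' - a' * b) * h

theorem leftMulHom_ρ : leftMulHom p ρ = affinePerm u₂ u₃ v₂ v₃ 0 0 1 := by
  ext g <;> simp [leftMulHom, ρ, add_comm]

theorem leftMulHom_mul_α₁ (m n : ℕ) :
    leftMulHom p (σ ^ m * τ ^ n) * MulAut.toPerm (Heisenberg p) α₁ =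
      affinePerm (m : ZMod p) n v₂ v₃ 1 0 0 := by
  rw [σ_pow_mul_τ_pow]
  refine Equiv.ext fun g => ?_
  change (⟨m, n, 0⟩ : Heisenberg p) * ⟨g.x, g.y, g.z + g.x⟩ = _
  ext <;> simp <;> ring

theorem leftMulHom_mul_α₃ (m n : ℕ) :
    leftMulHom p (σ ^ m * τ ^ n) * MulAut.toPerm (Heisenberg p) α₃ =
      affinePerm u₂ u₃ (m : ZMod p) n 0 1 0 := by
  rw [σ_pow_mul_τ_pow]
  refine Equiv.ext fun g => ?_
  change (⟨m, n, 0⟩ : Heisenberg p) * ⟨g.x, g.y, g.z + g.y⟩ = _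
  ext <;> simp <;> ring

end Heisenberg

/-- For `u = σ^{u₂}τ^{u₃}`, `v = σ^{v₂}τ^{v₃}`, the subgroup
`G = ⟨ρ, uα₁, vα₃⟩` of `Hol(M₁)` has order `p³`; it is regular iff `u₂v₃ − u₃v₂ ≢ 0 (mod p)`
and abelian iff `v₂ ≡ u₃ + u₂v₃ − u₃v₂ (mod p)`. -/
theorem case_I_subgroups (p : ℕ) [Fact p.Prime] (h3 : 3 < p)
    (u₂ u₃ v₂ v₃ : ℕ) (hu₂ : u₂ < p) (hu₃ : u₃ < p) (hv₂ : v₂ < p) (hv₃ : v₃ < p) :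
    ∀ G : Subgroup (Equiv.Perm (Heisenberg p)),
      G = Subgroup.closure {leftMulHom p ρ,
        leftMulHom p (σ ^ u₂ * τ ^ u₃) * MulAut.toPerm (Heisenberg p) α₁,
        leftMulHom p (σ ^ v₂ * τ ^ v₃) * MulAut.toPerm (Heisenberg p) α₃} →
      Nat.card G = p ^ 3 ∧
      (IsRegularSub G ↔ (u₂ : ZMod p) * (v₃ : ZMod p) - (u₃ : ZMod p) * (v₂ : ZMod p) ≠ 0) ∧
      ((∀ g ∈ G, ∀ h ∈ G, g * h = h * g) ↔
        (v₂ : ZMod p) = (u₃ : ZMod p) + (u₂ : ZMod p) * (v₃ : ZMod p) -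
          (u₃ : ZMod p) * (v₂ : ZMod p)) := by
  rintro G rfl
  rw [leftMulHom_ρ u₂ u₃ v₂ v₃, leftMulHom_mul_α₁ v₂ v₃, leftMulHom_mul_α₃ u₂ u₃,
    closure_affinePerm]
  exact ⟨card_affineSubgroup .., isRegularSub_affineSubgroup_iff ..,
    affineSubgroup_commutative_iff ..⟩
end
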